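/- arXiv:2402.09131 — 3 statements merged into one kernel-verified Lean document; each statement's English description precedes it below -/
import Mathlib

section
/- Let P be a penny configuration in general position with n points. Then the number of unordered pairs of points of P at distance exactly 1 is at most 43n/18 (equivalently, 18·e ≤ 43·n, where e is the number of edges of the penny graph of P). -/
open Real EuclideanGeometry

/-- The Euclidean plane. -/
abbrev Pt := EuclideanSpace ℝ (Fin 2)

/-- A penny configuration in general position: a finite set of points in the plane
such that any two distinct points are at distance at least 1 and no three points
are collinear. -/
def PennyGP (P : Finset Pt) : Prop :=
  (∀ p ∈ P, ∀ q ∈ P, p ≠ q → 1 ≤ dist p q) ∧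
  (∀ p ∈ P, ∀ q ∈ P, ∀ r ∈ P, p ≠ q → p ≠ r → q ≠ r →
    ¬ Collinear ℝ ({p, q, r} : Set Pt))

/-- The edges of the penny graph of `P`: unordered pairs of distinct points of `P`
at distance exactly 1. -/
def pennyEdges (P : Finset Pt) : Set (Sym2 Pt) :=
  {e | ∃ p ∈ P, ∃ q ∈ P, p ≠ q ∧ dist p q = 1 ∧ e = s(p, q)}

namespace PennyGraph

/-- The unit complex number with argument `t`. -/
noncomputable def cis (t : ℝ) : ℂ := ⟨Real.cos t, Real.sin t⟩

@[simp] lemma cis_re (t : ℝ) : (cis t).re = Real.cos t := rfl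

@[simp] lemma cis_im (t : ℝ) : (cis t).im = Real.sin t := rfl

lemma cis_add (s t : ℝ) : cis (s + t) = cis s * cis t := by
  apply Complex.ext
  · simp [Real.cos_add]
  · simp [Real.sin_add]; ring

lemma cis_zero : cis 0 = 1 := by
  apply Complex.ext <;> simp

lemma cis_pi : cis π = -1 := by
  apply Complex.ext <;> simp

lemma cis_two_pi : cis (2 * π) = 1 := by
  apply Complex.ext <;> simp

lemma cis_mul_neg (t : ℝ) : cis t * cis (-t) = 1 := by
  rw [← cis_add, add_neg_cancel, cis_zero]

lemma cis_neg_mul (t : ℝ) : cis (-t) * cis t = 1 := by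
  rw [← cis_add, neg_add_cancel, cis_zero]

lemma normSq_cis (t : ℝ) : Complex.normSq (cis t) = 1 := by
  rw [Complex.normSq_apply, cis_re, cis_im]
  nlinarith [Real.sin_sq_add_cos_sq t]

lemma norm_cis (t : ℝ) : ‖cis t‖ = 1 := by
  have h : ‖cis t‖ ^ 2 = 1 := by rw [← Complex.normSq_eq_norm_sq, normSq_cis]
  nlinarith [norm_nonneg (cis t)]

lemma cis_ne_zero (t : ℝ) : cis t ≠ 0 := by
  intro h
  have := norm_cis t
  rw [h, norm_zero] at this
  exact zero_ne_one this

lemma cis_ne_one {t : ℝ} (h0 : 0 < t) (h1 : t < 2 * π) : cis t ≠ 1 := by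
  intro h
  have hc : Real.cos t = 1 := by simpa using congrArg Complex.re h
  rw [Real.cos_eq_one_iff_of_lt_of_lt (by linarith [Real.pi_pos]) h1] at hc
  linarith

/-- Every unit complex number is `cis t` for some `t` in `[0, 2 * π)`. -/
lemma exists_cis {z : ℂ} (hz : ‖z‖ = 1) : ∃ t, 0 ≤ t ∧ t < 2 * π ∧ z = cis t := by
  have hz' : z = cis z.arg := by
    have h := Complex.norm_mul_cos_add_sin_mul_I z
    rw [hz] at h
    apply Complex.ext
    · have := congrArg Complex.re h
      simpa [Complex.cos_ofReal_re] using this.symm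
    · have := congrArg Complex.im h
      simpa [Complex.sin_ofReal_re] using this.symm
  rcases le_or_gt 0 z.arg with h | h
  · exact ⟨z.arg, h, by linarith [Complex.arg_le_pi z, Real.pi_pos], hz'⟩
  · refine ⟨z.arg + 2 * π, by linarith [Complex.neg_pi_lt_arg z], by linarith, ?_⟩
    rw [cis_add, cis_two_pi, mul_one]; exact hz'

lemma normSq_cis_sub_one (t : ℝ) : Complex.normSq (cis t - 1) = 2 - 2 * Real.cos t := by
  rw [Complex.normSq_apply]
  simp only [Complex.sub_re, Complex.sub_im, cis_re, cis_im, Complex.one_re, Complex.one_im]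
  nlinarith [Real.sin_sq_add_cos_sq t]

/-- A finite set of points of the complex plane at mutual distances at least `1`
with no three points on a line. -/
structure Config (P : Finset ℂ) : Prop where
  sep : ∀ p ∈ P, ∀ q ∈ P, p ≠ q → 1 ≤ ‖p - q‖
  gp : ∀ p ∈ P, ∀ q ∈ P, ∀ r ∈ P, p ≠ q → p ≠ r → q ≠ r → ∀ t : ℝ, q - p ≠ t * (r - p)

/-- The neighbours of `v` in the penny graph of `P`. -/
noncomputable def nb (P : Finset ℂ) (v : ℂ) : Finset ℂ := P.filter (fun u => ‖u - v‖ = 1)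

lemma mem_nb {P : Finset ℂ} {v u : ℂ} : u ∈ nb P v ↔ u ∈ P ∧ ‖u - v‖ = 1 := by
  simp [nb]

lemma mem_nb_comm {P : Finset ℂ} {v u : ℂ} (hv : v ∈ P) (hu : u ∈ nb P v) : v ∈ nb P u := by
  rw [mem_nb] at hu ⊢
  exact ⟨hv, by rw [norm_sub_rev]; exact hu.2⟩

lemma sub_ne_zero_of_mem_nb {P : Finset ℂ} {v u : ℂ} (hu : u ∈ nb P v) : u - v ≠ 0 := by
  intro h
  have := (mem_nb.1 hu).2
  rw [h, norm_zero] at this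
  exact zero_ne_one this

/-- `Corner P v u x θ`: turning counterclockwise around `v`, the neighbour following `u` is `x`,
at angle `θ`. -/
structure Corner (P : Finset ℂ) (v u x : ℂ) (θ : ℝ) : Prop where
  mem : v ∈ P
  left : u ∈ nb P v
  right : x ∈ nb P v
  pos : 0 < θ
  le : θ ≤ 2 * π
  rot : x - v = cis θ * (u - v)
  free : ∀ w ∈ nb P v, ∀ φ, 0 < φ → φ < θ → w - v ≠ cis φ * (u - v)

variable {P : Finset ℂ}

lemma eq_of_normSq_lt_one (hP : Config P) {p q : ℂ} (hp : p ∈ P) (hq : q ∈ P)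
    (h : Complex.normSq (p - q) < 1) : p = q := by
  by_contra hne
  have h1 := hP.sep p hp q hq hne
  rw [Complex.normSq_eq_norm_sq] at h
  nlinarith

lemma normSq_of_mem_nb {v u : ℂ} (h : u ∈ nb P v) : Complex.normSq (u - v) = 1 := by
  rw [Complex.normSq_eq_norm_sq, (mem_nb.1 h).2, one_pow]

namespace Corner

variable {v u x : ℂ} {θ : ℝ}

lemma rot_neg (h : Corner P v u x θ) : u - v = cis (-θ) * (x - v) := by
  rw [h.rot, ← mul_assoc, cis_neg_mul, one_mul]

lemma free_neg (h : Corner P v u x θ) {w : ℂ} (hw : w ∈ nb P v) {φ : ℝ} (h0 : 0 < φ)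
    (h1 : φ < θ) : w - v ≠ cis (-φ) * (x - v) := by
  intro hh
  apply h.free w hw (θ - φ) (by linarith) (by linarith)
  rw [hh, h.rot, ← mul_assoc, ← cis_add]
  congr 2; ring

lemma unique_right {x' : ℂ} {θ' : ℝ} (h : Corner P v u x θ) (h' : Corner P v u x' θ') :
    θ = θ' ∧ x = x' := by
  have : θ = θ' := by
    rcases lt_trichotomy θ θ' with hlt | heq | hgt
    · exact absurd h.rot (h'.free x h.right θ h.pos hlt)
    · exact heq
    · exact absurd h'.rot (h.free x' h'.right θ' h'.pos hgt)
  refine ⟨this, ?_⟩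
  have h1 := h.rot
  rw [this, ← h'.rot] at h1
  exact sub_left_injective h1

lemma unique_left {u' : ℂ} {θ' : ℝ} (h : Corner P v u x θ) (h' : Corner P v u' x θ') :
    θ = θ' ∧ u = u' := by
  have : θ = θ' := by
    rcases lt_trichotomy θ θ' with hlt | heq | hgt
    · exact absurd h.rot_neg (h'.free_neg h.left h.pos hlt)
    · exact heq
    · exact absurd h'.rot_neg (h.free_neg h'.left h'.pos hgt)
  refine ⟨this, ?_⟩
  have h1 := h.rot_neg
  rw [this, ← h'.rot_neg] at h1
  exact sub_left_injective h1

lemma normSq_diag (h : Corner P v u x θ) : Complex.normSq (x - u) = 2 - 2 * Real.cos θ := by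
  have : x - u = (cis θ - 1) * (u - v) := by linear_combination h.rot
  rw [this, Complex.normSq_mul, normSq_of_mem_nb h.left, mul_one, normSq_cis_sub_one]

lemma ge (hP : Config P) (h : Corner P v u x θ) : π / 3 ≤ θ := by
  by_contra hlt
  push Not at hlt
  have hc : 1 / 2 < Real.cos θ := by
    rw [← Real.cos_pi_div_three]
    exact Real.cos_lt_cos_of_nonneg_of_le_pi h.pos.le (by linarith [Real.pi_pos]) hlt
  have hd := h.normSq_diag
  have hxu : x = u := eq_of_normSq_lt_one hP (mem_nb.1 h.right).1 (mem_nb.1 h.left).1 (by linarith)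
  apply cis_ne_one h.pos (by linarith [Real.pi_pos])
  have h1 := h.rot
  rw [hxu] at h1
  exact mul_right_cancel₀ (sub_ne_zero_of_mem_nb h.left) (by rw [one_mul]; exact h1.symm)

end Corner

lemma normSq_cis_add_cis_sub_one (A B : ℝ) :
    Complex.normSq (cis A - 1 + cis (-B)) - 1
      = 4 * Real.cos ((A + B) / 2) * (Real.cos ((A + B) / 2) - Real.cos ((A - B) / 2)) := by
  obtain ⟨s, d, rfl, rfl⟩ : ∃ s d, A = s + d ∧ B = s - d :=
    ⟨(A + B) / 2, (A - B) / 2, by ring, by ring⟩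
  rw [Complex.normSq_apply]
  simp only [Complex.sub_re, Complex.sub_im, Complex.add_re, Complex.add_im, cis_re, cis_im,
    Complex.one_re, Complex.one_im, Real.cos_neg, Real.sin_neg]
  rw [show (s + d + (s - d)) / 2 = s by ring, show (s + d - (s - d)) / 2 = d by ring,
    Real.cos_add, Real.sin_add, Real.cos_sub, Real.sin_sub]
  linear_combination (4 * Real.cos s ^ 2) * Real.sin_sq_add_cos_sq d

/-- The two corners on the same side of an edge `vu` either belong to an equilateral triangle,
or their angles add up to at least `π`, with equality only in case of a rhombus. -/
lemma side (hP : Config P) {v u x y : ℂ} {A B : ℝ} (hA : Corner P v u x A)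
    (hB : Corner P u y v B) :
    (A = π / 3 ∧ B = π / 3 ∧ x = y) ∨
      (π / 3 < A ∧ π / 3 < B ∧ π ≤ A + B ∧ (A + B = π → y = x + u - v)) := by
  have hpi := Real.pi_pos
  have hA3 := hA.ge hP
  have hB3 := hB.ge hP
  have hx := hA.rot
  have hy := hB.rot_neg
  have hw : cis (π / 3) - 1 = cis (2 * (π / 3)) := by
    apply Complex.ext
    · simp only [Complex.sub_re, cis_re, Complex.one_re, Real.cos_two_mul, Real.cos_pi_div_three]
      norm_num
    · simp only [Complex.sub_im, cis_im, Complex.one_im, Real.sin_two_mul, Real.cos_pi_div_three]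
      ring
  have hw2 : cis (2 * (π / 3)) = - cis (-(π / 3)) := by
    have h1 : cis (2 * (π / 3)) * 1 = - cis (-(π / 3)) := by
      have h2 : cis (2 * (π / 3)) = cis π * cis (-(π / 3)) := by
        rw [← cis_add]; congr 1; ring
      rw [h2, cis_pi]; ring
    simpa using h1
  by_cases hA0 : A = π / 3
  · left
    subst hA0
    have hxu : x - u = cis (-(π / 3)) * (v - u) := by
      have : x - u = (cis (π / 3) - 1) * (u - v) := by linear_combination hx
      rw [this, hw, hw2]; ring
    have hxn : x ∈ nb P u := by
      rw [mem_nb]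
      refine ⟨(mem_nb.1 hA.right).1, ?_⟩
      rw [hxu, norm_mul, norm_cis, one_mul]
      exact (mem_nb.1 hB.right).2
    have hB0 : B = π / 3 := by
      rcases lt_or_eq_of_le hB3 with h | h
      · exact absurd hxu (hB.free_neg hxn hA.pos h)
      · exact h.symm
    refine ⟨rfl, hB0, ?_⟩
    rw [hB0, ← hxu] at hy
    exact (sub_left_injective hy).symm
  by_cases hB0 : B = π / 3
  · exfalso
    subst hB0
    have hyv : y - v = cis (π / 3) * (u - v) := by
      have : y - v = (1 - cis (-(π / 3))) * (u - v) := by linear_combination hy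
      rw [this]
      congr 1
      linear_combination -hw - hw2
    have hyn : y ∈ nb P v := by
      rw [mem_nb]
      refine ⟨(mem_nb.1 hB.left).1, ?_⟩
      rw [hyv, norm_mul, norm_cis, one_mul]
      exact (mem_nb.1 hA.left).2
    exact hA.free y hyn _ hB.pos (lt_of_le_of_ne hA3 (Ne.symm hA0)) hyv
  right
  have hA1 : π / 3 < A := lt_of_le_of_ne hA3 (Ne.symm hA0)
  have hB1 : π / 3 < B := lt_of_le_of_ne hB3 (Ne.symm hB0)
  refine ⟨hA1, hB1, ?_, ?_⟩
  · by_contra hlt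
    push Not at hlt
    have hxy : x - y = (cis A - 1 + cis (-B)) * (u - v) := by linear_combination hx - hy
    have hcs : 0 < Real.cos ((A + B) / 2) := Real.cos_pos_of_mem_Ioo ⟨by linarith, by linarith⟩
    have hcd : Real.cos ((A + B) / 2) < Real.cos ((A - B) / 2) := by
      rw [← Real.cos_abs ((A - B) / 2)]
      apply Real.cos_lt_cos_of_nonneg_of_le_pi (abs_nonneg _) (by linarith)
      rw [abs_lt]
      constructor <;> linarith
    have hn : Complex.normSq (x - y) < 1 := by
      rw [hxy, Complex.normSq_mul, normSq_of_mem_nb hA.left, mul_one]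
      have := normSq_cis_add_cis_sub_one A B
      nlinarith [mul_pos hcs (sub_pos.2 hcd)]
    have he : x = y := eq_of_normSq_lt_one hP (mem_nb.1 hA.right).1 (mem_nb.1 hB.left).1 hn
    have hd := hA.normSq_diag
    rw [he, normSq_of_mem_nb hB.left] at hd
    have : Real.cos A < Real.cos (π / 3) :=
      Real.cos_lt_cos_of_nonneg_of_le_pi (by linarith) (by linarith) hA1
    rw [Real.cos_pi_div_three] at this
    linarith
  · intro hAB
    have hc : cis (-B) = - cis A := by
      have : cis (-B) = cis A * cis (-π) := by rw [← cis_add]; congr 1; linarith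
      have hp : cis (-π) = -1 := by apply Complex.ext <;> simp
      rw [this, hp]; ring
    rw [hc] at hy
    linear_combination hy - hx

lemma cis_inj {s t : ℝ} (hs : 0 ≤ s) (hs' : s < 2 * π) (ht : 0 ≤ t) (ht' : t < 2 * π)
    (h : cis s = cis t) : s = t := by
  have key : ∀ x y : ℝ, cis x = cis y → cis (y - x) = 1 := by
    intro x y hxy
    rw [sub_eq_add_neg, cis_add, ← hxy, cis_mul_neg]
  rcases lt_trichotomy s t with hlt | heq | hgt
  · exact absurd (key s t h) (cis_ne_one (by linarith) (by linarith))
  · exact heq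
  · exact absurd (key t s h.symm) (cis_ne_one (by linarith) (by linarith))

/-- The neighbours of `v`, sorted counterclockwise starting from `u`. -/
lemma exists_angles {v u : ℂ} (hv : v ∈ P) (hu : u ∈ nb P v) :
    ∃ s : ℕ → ℝ, s 0 = 0 ∧ s (nb P v).card = 2 * π ∧
      (∀ i < (nb P v).card, Corner P v (v + cis (s i) * (u - v)) (v + cis (s (i + 1)) * (u - v))
        (s (i + 1) - s i)) ∧
      ∀ w ∈ nb P v, ∃ i < (nb P v).card, w = v + cis (s i) * (u - v) := by
  classical
  have hpi := Real.pi_pos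
  have hu0 : u - v ≠ 0 := sub_ne_zero_of_mem_nb hu
  have hang : ∀ w ∈ nb P v, ∃ t, 0 ≤ t ∧ t < 2 * π ∧ w - v = cis t * (u - v) := by
    intro w hw
    obtain ⟨t, h0, h1, h2⟩ := exists_cis (z := (w - v) / (u - v)) (by
      rw [norm_div, (mem_nb.1 hw).2, (mem_nb.1 hu).2, div_one])
    exact ⟨t, h0, h1, by rw [← h2, div_mul_cancel₀ _ hu0]⟩
  choose! f hf0 hf1 hf2 using hang
  set S : Finset ℝ := (nb P v).image f with hS
  have hinj : Set.InjOn f (nb P v : Set ℂ) := by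
    intro x hx y hy hxy
    have h1 := hf2 x hx
    rw [hxy, ← hf2 y hy] at h1
    exact sub_left_injective h1
  have hcard : S.card = (nb P v).card := Finset.card_image_of_injOn hinj
  set n := (nb P v).card with hn
  have hn0 : 0 < n := Finset.card_pos.2 ⟨u, hu⟩
  have hfu : f u = 0 := by
    apply cis_inj (hf0 u hu) (hf1 u hu) le_rfl (by linarith)
    have := hf2 u hu
    rw [cis_zero]
    exact mul_right_cancel₀ hu0 (by rw [one_mul]; exact this.symm)
  have hS0 : (0 : ℝ) ∈ S := Finset.mem_image.2 ⟨u, hu, hfu⟩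
  have hSb : ∀ t ∈ S, 0 ≤ t ∧ t < 2 * π := by
    intro t ht
    obtain ⟨w, hw, rfl⟩ := Finset.mem_image.1 ht
    exact ⟨hf0 w hw, hf1 w hw⟩
  have hSn : ∀ t ∈ S, v + cis t * (u - v) ∈ nb P v := by
    intro t ht
    obtain ⟨w, hw, rfl⟩ := Finset.mem_image.1 ht
    rw [← hf2 w hw, add_sub_cancel]; exact hw
  set e := S.orderEmbOfFin hcard with he
  let s : ℕ → ℝ := fun i => if h : i < n then e ⟨i, h⟩ else 2 * π
  have hs : ∀ i (h : i < n), s i = e ⟨i, h⟩ := fun i h => dif_pos h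
  have hsn : s n = 2 * π := dif_neg (lt_irrefl n)
  have hsS : ∀ i, i < n → s i ∈ S := fun i h => by
    rw [hs i h]; exact Finset.orderEmbOfFin_mem S hcard _
  have hmono : ∀ i j, i < j → j ≤ n → s i < s j := by
    intro i j hij hj
    rcases lt_or_eq_of_le hj with hj' | rfl
    · rw [hs i (by omega), hs j hj']
      exact e.strictMono (by simpa using hij)
    · rw [hsn]; exact (hSb _ (hsS i hij)).2
  have hsurj : ∀ t ∈ S, ∃ i < n, t = s i := by
    intro t ht
    have : t ∈ Set.range e := by rw [he, Finset.range_orderEmbOfFin]; exact ht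
    obtain ⟨i, rfl⟩ := this
    exact ⟨i, i.2, (hs i i.2).symm⟩
  have hs0 : s 0 = 0 := by
    obtain ⟨i, hi, h⟩ := hsurj 0 hS0
    rcases Nat.eq_zero_or_pos i with rfl | hpos
    · exact h.symm
    · have h1 := hmono 0 i hpos hi.le
      have h2 := (hSb _ (hsS 0 hn0)).1
      linarith
  refine ⟨s, hs0, hsn, ?_, ?_⟩
  · intro i hi
    have h0 := (hSb _ (hsS i hi)).1
    have h1 := hmono i (i + 1) (by omega) (by omega)
    have h2 : s (i + 1) ≤ 2 * π := by
      rcases lt_or_eq_of_le (show i + 1 ≤ n by omega) with h | h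
      · exact (hSb _ (hsS _ h)).2.le
      · rw [h, hsn]
    refine ⟨hv, hSn _ (hsS i hi), ?_, by linarith, by linarith, ?_, ?_⟩
    · rcases lt_or_eq_of_le (show i + 1 ≤ n by omega) with h | h
      · exact hSn _ (hsS _ h)
      · rw [h, hsn, cis_two_pi, one_mul, add_sub_cancel]; exact hu
    · rw [add_sub_cancel_left, add_sub_cancel_left, ← mul_assoc, ← cis_add]
      congr 2; ring
    · intro w hw φ hφ0 hφ1 hwφ
      rw [add_sub_cancel_left, ← mul_assoc, ← cis_add, hf2 w hw] at hwφ
      have h3 := cis_inj (hf0 w hw) (hf1 w hw) (by linarith) (by linarith)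
        (mul_right_cancel₀ hu0 hwφ)
      obtain ⟨j, hj, h4⟩ := hsurj (f w) (Finset.mem_image.2 ⟨w, hw, rfl⟩)
      rcases le_or_gt j i with hji | hij
      · have : s j ≤ s i := by
          rcases lt_or_eq_of_le hji with h | h
          · exact (hmono j i h hi.le).le
          · rw [h]
        linarith
      · have : s (i + 1) ≤ s j := by
          rcases lt_or_eq_of_le (show i + 1 ≤ j by omega) with h | h
          · exact (hmono _ j h hj.le).le
          · rw [h]
        linarith
  · intro w hw
    obtain ⟨i, hi, h⟩ := hsurj (f w) (Finset.mem_image.2 ⟨w, hw, rfl⟩)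
    exact ⟨i, hi, by rw [← h, ← hf2 w hw, add_sub_cancel]⟩

/-- Opposite neighbours of a point are collinear with it. -/
lemma not_opposite (hP : Config P) {v u x : ℂ} (hv : v ∈ P) (hu : u ∈ nb P v) (hx : x ∈ nb P v)
    (h : x - v = -(u - v)) : False := by
  have hu0 := sub_ne_zero_of_mem_nb hu
  have hx0 := sub_ne_zero_of_mem_nb hx
  have hux : u ≠ x := by
    rintro rfl
    apply hu0
    linear_combination h / 2
  refine hP.gp v hv u (mem_nb.1 hu).1 x (mem_nb.1 hx).1 ?_ ?_ hux (-1) ?_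
  · rintro rfl; simp at hu0
  · rintro rfl; simp at hx0
  · push_cast; linear_combination h

lemma card_nb_le_five (hP : Config P) {v : ℂ} (hv : v ∈ P) : (nb P v).card ≤ 5 := by
  by_contra hlt
  push Not at hlt
  have hpi := Real.pi_pos
  obtain ⟨u, hu⟩ := Finset.card_pos.1 (show 0 < (nb P v).card by omega)
  obtain ⟨s, h0, hn, hc, -⟩ := exists_angles hv hu
  set n := (nb P v).card
  have hstep : ∀ i < n, s i + π / 3 ≤ s (i + 1) := fun i hi => by
    have := (hc i hi).ge hP
    linarith
  have h3 : π ≤ s 3 := by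
    have := hstep 0 (by omega); have := hstep 1 (by omega); have := hstep 2 (by omega)
    norm_num at *; linarith
  have hgrow : ∀ k, 6 + k ≤ n → s 6 ≤ s (6 + k) := by
    intro k
    induction k with
    | zero => intro _; exact le_rfl
    | succ k ih =>
      intro hk
      have := hstep (6 + k) (by omega)
      have := ih (by omega)
      rw [← add_assoc]; linarith
  have h6 : s 6 ≤ 2 * π := by
    have := hgrow (n - 6) (by omega)
    rwa [show 6 + (n - 6) = n by omega, hn] at this
  have h3' : s 3 = π := by
    have := hstep 3 (by omega); have := hstep 4 (by omega); have := hstep 5 (by omega)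
    norm_num at *; linarith
  have hx := (hc 2 (by omega)).right
  norm_num at hx
  rw [h3', cis_pi] at hx
  exact not_opposite hP hv hu hx (by ring)

/-- The cyclically ordered neighbourhood of a vertex of degree five. -/
structure Star5 (P : Finset ℂ) (v u0 u1 u2 u3 u4 : ℂ) (a0 a1 a2 a3 a4 : ℝ) : Prop where
  c0 : Corner P v u0 u1 a0
  c1 : Corner P v u1 u2 a1
  c2 : Corner P v u2 u3 a2
  c3 : Corner P v u3 u4 a3
  c4 : Corner P v u4 u0 a4
  sum : a0 + a1 + a2 + a3 + a4 = 2 * π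
  surj : ∀ w ∈ nb P v, w = u0 ∨ w = u1 ∨ w = u2 ∨ w = u3 ∨ w = u4

/-- The cyclically ordered neighbourhood of a vertex of degree four. -/
structure Star4 (P : Finset ℂ) (v u0 u1 u2 u3 : ℂ) (a0 a1 a2 a3 : ℝ) : Prop where
  c0 : Corner P v u0 u1 a0
  c1 : Corner P v u1 u2 a1
  c2 : Corner P v u2 u3 a2
  c3 : Corner P v u3 u0 a3
  sum : a0 + a1 + a2 + a3 = 2 * π
  surj : ∀ w ∈ nb P v, w = u0 ∨ w = u1 ∨ w = u2 ∨ w = u3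

lemma exists_star5 {v u0 : ℂ} (hv : v ∈ P) (h5 : (nb P v).card = 5) (hu : u0 ∈ nb P v) :
    ∃ u1 u2 u3 u4 a0 a1 a2 a3 a4, Star5 P v u0 u1 u2 u3 u4 a0 a1 a2 a3 a4 := by
  obtain ⟨s, h0, hn, hc, hs⟩ := exists_angles hv hu
  rw [h5] at hn hc hs
  have c0 := hc 0 (by omega)
  have c4 := hc 4 (by omega)
  norm_num at c0 c4
  rw [hn, cis_two_pi, one_mul, add_sub_cancel] at c4
  rw [h0, cis_zero, one_mul, add_sub_cancel, sub_zero] at c0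
  refine ⟨_, _, _, _, _, _, _, _, _, c0, hc 1 (by omega), hc 2 (by omega), hc 3 (by omega), c4,
    by ring, ?_⟩
  intro w hw
  obtain ⟨i, hi, rfl⟩ := hs w hw
  interval_cases i <;> simp [h0, cis_zero]

lemma exists_star4 {v u0 : ℂ} (hv : v ∈ P) (h4 : (nb P v).card = 4) (hu : u0 ∈ nb P v) :
    ∃ u1 u2 u3 a0 a1 a2 a3, Star4 P v u0 u1 u2 u3 a0 a1 a2 a3 := by
  obtain ⟨s, h0, hn, hc, hs⟩ := exists_angles hv hu
  rw [h4] at hn hc hs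
  have c0 := hc 0 (by omega)
  have c3 := hc 3 (by omega)
  norm_num at c0 c3
  rw [hn, cis_two_pi, one_mul, add_sub_cancel] at c3
  rw [h0, cis_zero, one_mul, add_sub_cancel, sub_zero] at c0
  refine ⟨_, _, _, _, _, _, _, c0, hc 1 (by omega), hc 2 (by omega), c3, by ring, ?_⟩
  intro w hw
  obtain ⟨i, hi, rfl⟩ := hs w hw
  interval_cases i <;> simp [h0, cis_zero]

lemma Star5.rotate {v u0 u1 u2 u3 u4 : ℂ} {a0 a1 a2 a3 a4 : ℝ}
    (h : Star5 P v u0 u1 u2 u3 u4 a0 a1 a2 a3 a4) : Star5 P v u1 u2 u3 u4 u0 a1 a2 a3 a4 a0 :=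
  ⟨h.c1, h.c2, h.c3, h.c4, h.c0, by linarith [h.sum], fun w hw => by
    rcases h.surj w hw with h | h | h | h | h <;> simp [h]⟩

lemma Star4.rotate {v u0 u1 u2 u3 : ℂ} {a0 a1 a2 a3 : ℝ}
    (h : Star4 P v u0 u1 u2 u3 a0 a1 a2 a3) : Star4 P v u1 u2 u3 u0 a1 a2 a3 a0 :=
  ⟨h.c1, h.c2, h.c3, h.c0, by linarith [h.sum], fun w hw => by
    rcases h.surj w hw with h | h | h | h <;> simp [h]⟩

lemma cis_third_sq : cis (π / 3) * cis (π / 3) = cis (π / 3) - 1 := by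
  rw [← cis_add, show π / 3 + π / 3 = 2 * (π / 3) by ring]
  apply Complex.ext
  · simp only [Complex.sub_re, cis_re, Complex.one_re, Real.cos_two_mul, Real.cos_pi_div_three]
    norm_num
  · simp only [Complex.sub_im, cis_im, Complex.one_im, Real.sin_two_mul, Real.cos_pi_div_three]
    ring

lemma cis_neg_third : cis (-(π / 3)) = 1 - cis (π / 3) := by
  apply mul_left_cancel₀ (cis_ne_zero (π / 3))
  rw [cis_mul_neg]
  linear_combination cis_third_sq

lemma conj_cis (t : ℝ) : (starRingEnd ℂ) (cis t) = cis (-t) := by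
  apply Complex.ext <;> simp

lemma Corner.ne_third_lt (hP : Config P) {v u x : ℂ} {θ : ℝ} (h : Corner P v u x θ)
    (hne : θ ≠ π / 3) : π / 3 < θ := lt_of_le_of_ne (h.ge hP) (Ne.symm hne)

/-- Two corners at a common edge, the first of which is equilateral. -/
lemma side_left (hP : Config P) {v u x y : ℂ} {A B : ℝ} (hA : Corner P v u x A)
    (hB : Corner P u y v B) (h : A = π / 3) : B = π / 3 ∧ x = y := by
  rcases side hP hA hB with hs | hs
  · exact hs.2
  · linarith [hs.1]

/-- Two corners at a common edge, the second of which is equilateral. -/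
lemma side_right (hP : Config P) {v u x y : ℂ} {A B : ℝ} (hA : Corner P v u x A)
    (hB : Corner P u y v B) (h : B = π / 3) : A = π / 3 ∧ x = y := by
  rcases side hP hA hB with hs | hs
  · exact ⟨hs.1, hs.2.2⟩
  · linarith [hs.2.1]

/-- Two corners at a common edge, the first of which is not equilateral. -/
lemma wide_left (hP : Config P) {v u x y : ℂ} {A B : ℝ} (hA : Corner P v u x A)
    (hB : Corner P u y v B) (h : A ≠ π / 3) :
    π / 3 < A ∧ π / 3 < B ∧ π ≤ A + B ∧ (A + B = π → y = x + u - v) := by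
  rcases side hP hA hB with hs | hs
  · exact absurd hs.1 h
  · exact hs

/-- Two corners at a common edge, the second of which is not equilateral. -/
lemma wide_right (hP : Config P) {v u x y : ℂ} {A B : ℝ} (hA : Corner P v u x A)
    (hB : Corner P u y v B) (h : B ≠ π / 3) :
    π / 3 < A ∧ π / 3 < B ∧ π ≤ A + B ∧ (A + B = π → y = x + u - v) := by
  rcases side hP hA hB with hs | hs
  · exact absurd hs.2.1 h
  · exact hs

/-- Three consecutive corners do not form a straight angle. -/
lemma not_straight (hP : Config P) {v u0 u1 u2 u3 : ℂ} {a0 a1 a2 : ℝ} (h0 : Corner P v u0 u1 a0)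
    (h1 : Corner P v u1 u2 a1) (h2 : Corner P v u2 u3 a2) : a0 + a1 + a2 ≠ π := by
  intro h
  apply not_opposite hP h0.mem h0.left h2.right
  rw [h2.rot, h1.rot, h0.rot, ← mul_assoc, ← mul_assoc, ← cis_add, ← cis_add,
    show a2 + a1 + a0 = π by linarith, cis_pi]
  ring

lemma not_three (hP : Config P) {v u0 u1 u2 u3 : ℂ} {a0 a1 a2 : ℝ} (h0 : Corner P v u0 u1 a0)
    (h1 : Corner P v u1 u2 a1) (h2 : Corner P v u2 u3 a2) (e0 : a0 = π / 3) (e1 : a1 = π / 3)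
    (e2 : a2 = π / 3) : False :=
  not_straight hP h0 h1 h2 (by rw [e0, e1, e2]; ring)

section Star5

variable {v u0 u1 u2 u3 u4 : ℂ} {a0 a1 a2 a3 a4 : ℝ}

/-- Two consecutive corners at a vertex of degree five add up to less than `π`. -/
lemma Star5.add_lt (hP : Config P) (h : Star5 P v u0 u1 u2 u3 u4 a0 a1 a2 a3 a4) :
    a0 + a1 < π := by
  have h2 := h.c2.ge hP
  have h3 := h.c3.ge hP
  have h4 := h.c4.ge hP
  rcases lt_or_eq_of_le (show a0 + a1 ≤ π by linarith [h.sum]) with h' | h'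
  · exact h'
  · exact absurd (by linarith [h.sum]) (not_straight hP h.c2 h.c3 h.c4)

/-- Every corner at a vertex of degree five is less than `2 * π / 3`. -/
lemma Star5.lt (hP : Config P) (h : Star5 P v u0 u1 u2 u3 u4 a0 a1 a2 a3 a4) :
    a0 < 2 * π / 3 := by
  have := h.add_lt hP
  have := h.c1.ge hP
  linarith

/-- At an edge joining two vertices of degree five there is an equilateral triangle. -/
lemma Star5.third_or_third (hP : Config P) (h : Star5 P v u0 u1 u2 u3 u4 a0 a1 a2 a3 a4)
    (h5 : (nb P u1).card = 5) : a0 = π / 3 ∨ a1 = π / 3 := by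
  by_contra hne
  push Not at hne
  obtain ⟨x1, x2, x3, x4, b0, b1, b2, b3, b4, hx⟩ :=
    exists_star5 (mem_nb.1 h.c0.right).1 h5 (mem_nb_comm h.c0.mem h.c0.right)
  have e1 := wide_left hP h.c1 hx.c4 hne.2
  have e0 := wide_right hP hx.c0 h.c0 hne.1
  have := h.add_lt hP
  have := hx.rotate.rotate.rotate.rotate.add_lt hP
  linarith [e0.2.2.1, e1.2.2.1]

end Star5

lemma collinear_of_conj (hP : Config P) {v p q z w B : ℂ} (hv : v ∈ P) (hp : p ∈ P) (hq : q ∈ P)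
    (hz : z ≠ 0) (hw : w * w = w - 1) (hw' : (starRingEnd ℂ) w = 1 - w)
    (hB : (starRingEnd ℂ) B * B = 1) (hpz : p - v = z * (w * w + w * B)) (hqz : q - v = z * (1 - B))
    (h1 : B ≠ 1) (h2 : B ≠ -w) (h3 : B ≠ 1 - w) : False := by
  have hw0 : w ≠ 0 := by rintro rfl; norm_num at hw
  have h1' : 1 - B ≠ 0 := sub_ne_zero.2 h1.symm
  have hB0 : B ≠ 0 := by rintro rfl; simp at hB
  have hC : (starRingEnd ℂ) B = B⁻¹ := eq_inv_of_mul_eq_one_left hB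
  have h1'' : 1 - B⁻¹ ≠ 0 := by
    rw [sub_ne_zero]; intro h; apply h1; rw [← inv_inv B, ← h, inv_one]
  have hr : (starRingEnd ℂ) ((w * w + w * B) / (1 - B)) = (w * w + w * B) / (1 - B) := by
    rw [map_div₀, map_add, map_sub, map_mul, map_mul, map_one, hw', hC,
      div_eq_div_iff h1'' h1']
    have hBi : B⁻¹ * B = 1 := inv_mul_cancel₀ hB0
    linear_combination (B⁻¹ - B) * hw + (2 * w - 1) * hBi
  obtain ⟨t, ht⟩ := Complex.conj_eq_iff_real.1 hr
  have hne1 : v ≠ p := by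
    rintro rfl
    rw [sub_self, eq_comm, mul_eq_zero, or_iff_right hz, ← mul_add, mul_eq_zero,
      or_iff_right hw0] at hpz
    exact h2 (by linear_combination hpz)
  have hne2 : v ≠ q := by
    rintro rfl
    rw [sub_self, eq_comm, mul_eq_zero, or_iff_right hz] at hqz
    exact h1' hqz
  have hw1 : 1 + w ≠ 0 := by
    intro h
    have h5 : w = -1 := by linear_combination h
    rw [h5] at hw; norm_num at hw
  have hne3 : p ≠ q := by
    rintro rfl
    rw [hpz] at hqz
    have := mul_left_cancel₀ hz hqz
    apply h3
    apply mul_left_cancel₀ hw1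
    linear_combination this
  refine hP.gp v hv p hp q hq hne1 hne2 hne3 t ?_
  rw [← ht, hpz, hqz]
  field_simp

/-- The basic collinearity of the triangular lattice sheared along a rhombus. -/
lemma not_collinear_left (hP : Config P) {v p q z : ℂ} {β : ℝ} (hv : v ∈ P) (hp : p ∈ P)
    (hq : q ∈ P) (hz : z ≠ 0) (h0 : 0 < β) (h1 : β < π)
    (hpz : p - v = z * (cis (π / 3) * cis (π / 3) + cis (π / 3) * cis β))
    (hqz : q - v = z * (1 - cis β)) : False := by
  have hs : 0 < Real.sin β := Real.sin_pos_of_pos_of_lt_pi h0 h1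
  have hs3 : 0 < Real.sin (π / 3) :=
    Real.sin_pos_of_pos_of_lt_pi (by positivity) (by linarith [Real.pi_pos])
  refine collinear_of_conj hP hv hp hq hz cis_third_sq (by rw [conj_cis, cis_neg_third])
    (by rw [conj_cis, cis_neg_mul]) hpz hqz (cis_ne_one h0 (by linarith)) ?_ ?_
  · intro h
    have := congrArg Complex.im h
    simp only [Complex.neg_im, cis_im] at this
    linarith
  · intro h
    have := congrArg Complex.im h
    simp only [Complex.sub_im, Complex.one_im, cis_im] at this
    linarith

/-- The mirror image of `not_collinear_left`. -/
lemma not_collinear_right (hP : Config P) {v p q z : ℂ} {β : ℝ} (hv : v ∈ P) (hp : p ∈ P)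
    (hq : q ∈ P) (hz : z ≠ 0) (h0 : 0 < β) (h1 : β < π)
    (hpz : p - v = z * (cis (-(π / 3)) * cis (-(π / 3)) + cis (-(π / 3)) * cis (-β)))
    (hqz : q - v = z * (1 - cis (-β))) : False := by
  have hs : 0 < Real.sin β := Real.sin_pos_of_pos_of_lt_pi h0 h1
  have hs3 : 0 < Real.sin (π / 3) :=
    Real.sin_pos_of_pos_of_lt_pi (by positivity) (by linarith [Real.pi_pos])
  refine collinear_of_conj hP hv hp hq hz ?_ (by rw [conj_cis, cis_neg_third, neg_neg]; ring)
    (by rw [conj_cis, neg_neg, cis_mul_neg]) hpz hqz ?_ ?_ ?_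
  · rw [cis_neg_third]; linear_combination cis_third_sq
  · intro h
    have := congrArg Complex.im h
    simp only [Complex.one_im, cis_im, Real.sin_neg] at this
    linarith
  · intro h
    have := congrArg Complex.im h
    simp only [Complex.neg_im, cis_im, Real.sin_neg] at this
    linarith
  · intro h
    have := congrArg Complex.im h
    simp only [Complex.sub_im, Complex.one_im, cis_im, Real.sin_neg] at this
    linarith

/-- There is no pair of adjacent triangles all of whose four vertices have degree five. -/
lemma not_diamond (hP : Config P) {v a b c d e : ℂ} {a0 a1 a2 a3 a4 : ℝ}
    (h : Star5 P v a b c d e a0 a1 a2 a3 a4) (h0 : a0 = π / 3) (h1 : a1 = π / 3)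
    (ha : (nb P a).card = 5) (hb : (nb P b).card = 5) (hc : (nb P c).card = 5) : False := by
  have hpi := Real.pi_pos
  obtain ⟨b1, b2, b3, b4, β0, β1, β2, β3, β4, hbs⟩ :=
    exists_star5 (mem_nb.1 h.c1.left).1 hb (mem_nb_comm h.c0.mem h.c1.left)
  obtain ⟨h1', h2', h3', h4', χ0, χ1, χ2, χ3, χ4, has⟩ :=
    exists_star5 (mem_nb.1 h.c0.left).1 ha (mem_nb_comm h.c0.mem h.c0.left)
  obtain ⟨k1, k2, k3, k4, ψ0, ψ1, ψ2, ψ3, ψ4, hcs⟩ :=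
    exists_star5 (mem_nb.1 h.c2.left).1 hc (mem_nb_comm h.c0.mem h.c2.left)
  obtain ⟨hβ4, rfl⟩ := side_left hP h.c1 hbs.c4 h1
  obtain ⟨hβ0, rfl⟩ := side_right hP hbs.c0 h.c0 h0
  obtain ⟨hχ4, rfl⟩ := side_left hP h.c0 has.c4 h0
  obtain ⟨hψ0, rfl⟩ := side_right hP hcs.c0 h.c1 h1
  have n2 : a2 ≠ π / 3 := fun h2 => not_three hP h.c0 h.c1 h.c2 h0 h1 h2
  have n4 : a4 ≠ π / 3 := fun h4 => not_three hP h.c4 h.c0 h.c1 h4 h0 h1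
  have m1 : β1 ≠ π / 3 := fun h' => not_three hP hbs.c4 hbs.c0 hbs.c1 hβ4 hβ0 h'
  have m3 : β3 ≠ π / 3 := fun h' => not_three hP hbs.c3 hbs.c4 hbs.c0 h' hβ4 hβ0
  obtain ⟨-, -, e1, f1⟩ := wide_left hP h.c2 hcs.c4 n2
  obtain ⟨-, -, e2, f2⟩ := wide_right hP has.c0 h.c4 n4
  obtain ⟨-, -, e3, -⟩ := wide_left hP hbs.c1 has.c3 m1
  obtain ⟨-, -, e4, -⟩ := wide_right hP hcs.c1 hbs.c3 m3
  have g1 := h.c3.ge hP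
  have g2 := hbs.c2.ge hP
  have g3 := has.c1.ge hP
  have g4 := has.c2.ge hP
  have g5 := hcs.c2.ge hP
  have g6 := hcs.c3.ge hP
  have s1 := h.sum
  have s2 := hbs.sum
  have s3 := has.sum
  have s4 := hcs.sum
  have t3 : a3 = π / 3 := by linarith
  have p3 : ψ3 = π / 3 := by linarith
  have hk4 := f1 (by linarith)
  have hh1 := f2 (by linarith)
  have ra := h.c0.rot
  have rb := h.c1.rot
  have rc := h.c2.rot
  have rd := h.c3.rot
  have rk := hcs.c3.rot_neg
  rw [h0] at ra
  rw [h1, ra] at rb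
  rw [rb] at rc
  rw [t3, rc] at rd
  rw [p3, cis_neg_third, hk4] at rk
  have hw := cis_third_sq
  have hlt := h.rotate.rotate.lt hP
  refine not_collinear_left hP h.c0.mem (mem_nb.1 hcs.c3.left).1 (mem_nb.1 has.c0.right).1
    (sub_ne_zero_of_mem_nb h.c0.left) h.c2.pos (by linarith) ?_ ?_
  · linear_combination rk + rb + (1 - cis (π / 3)) * rc
      - cis (π / 3) * cis a2 * (b1 - v) * hw
  · linear_combination -hh1 + rd + cis a2 * (b1 - v) * (cis (π / 3) + 1) * hw

/-- Every vertex of degree five has a neighbour of smaller degree. -/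
lemma exists_nb_card_ne_five (hP : Config P) {v : ℂ} (hv : v ∈ P) (h5 : (nb P v).card = 5) :
    ∃ u ∈ nb P v, (nb P u).card ≠ 5 := by
  by_contra hall
  push Not at hall
  obtain ⟨u0, hu0⟩ := Finset.card_pos.1 (show 0 < (nb P v).card by omega)
  obtain ⟨u1, u2, u3, u4, a0, a1, a2, a3, a4, h⟩ := exists_star5 hv h5 hu0
  have h0 := hall _ h.c0.left
  have h1 := hall _ h.c1.left
  have h2 := hall _ h.c2.left
  have h3 := hall _ h.c3.left
  have h4 := hall _ h.c4.left
  have m0 := h.third_or_third hP h1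
  have m1 := h.rotate.third_or_third hP h2
  have m2 := h.rotate.rotate.third_or_third hP h3
  have m3 := h.rotate.rotate.rotate.third_or_third hP h4
  have m4 := h.rotate.rotate.rotate.rotate.third_or_third hP h0
  have d0 := fun x y => not_diamond hP h x y h0 h1 h2
  have d1 := fun x y => not_diamond hP h.rotate x y h1 h2 h3
  have d2 := fun x y => not_diamond hP h.rotate.rotate x y h2 h3 h4
  have d3 := fun x y => not_diamond hP h.rotate.rotate.rotate x y h3 h4 h0
  have d4 := fun x y => not_diamond hP h.rotate.rotate.rotate.rotate x y h4 h0 h1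
  tauto

lemma normSq_add_cis (s t x y : ℝ) :
    Complex.normSq ((s : ℂ) * cis x + (t : ℂ) * cis y) =
      s ^ 2 + t ^ 2 + 2 * s * t * Real.cos (y - x) := by
  rw [Complex.normSq_apply, Real.cos_sub]
  simp only [Complex.add_re, Complex.add_im, Complex.mul_re, Complex.mul_im, Complex.ofReal_re,
    Complex.ofReal_im, cis_re, cis_im]
  linear_combination s ^ 2 * Real.sin_sq_add_cos_sq x + t ^ 2 * Real.sin_sq_add_cos_sq y

lemma one_sub_cis (A : ℝ) :
    1 - cis (2 * A) = ((-2 * Real.sin A : ℝ) : ℂ) * Complex.I * cis A := by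
  apply Complex.ext
  · simp [Complex.mul_re, Complex.mul_im, -Complex.ofReal_sin, -Complex.ofReal_mul]
    rw [Real.cos_two_mul]
    linear_combination (-2) * Real.sin_sq_add_cos_sq A
  · simp [Complex.mul_re, Complex.mul_im, -Complex.ofReal_sin, -Complex.ofReal_mul]
    rw [Real.sin_two_mul]

lemma sin_sq_add_sin_sq_lt {A B : ℝ} (hA : π / 6 < A) (hA' : A < π / 3) (hB : π / 6 < B)
    (hB' : B < π / 3) :
    Real.sin A ^ 2 + Real.sin B ^ 2 + 2 * Real.sin A * Real.sin B * Real.cos (A + B + π / 3)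
      < 1 / 4 := by
  have key : Real.sin A ^ 2 + Real.sin B ^ 2
      + 2 * Real.sin A * Real.sin B * Real.cos (A + B + π / 3) - 1 / 4 =
      Real.cos (A + B - π / 3) * (Real.cos (A + B - π / 3) - Real.cos (A - B)) := by
    have h3 : Real.sin (π / 3) ^ 2 = 3 / 4 := by
      have := Real.sin_sq_add_cos_sq (π / 3)
      rw [Real.cos_pi_div_three] at this
      linarith
    rw [Real.cos_add (A + B), Real.cos_sub (A + B), Real.cos_pi_div_three, Real.cos_add,
      Real.sin_add, Real.cos_sub]
    have eA := Real.sin_sq_add_cos_sq A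
    have eB := Real.sin_sq_add_cos_sq B
    set x := Real.sin A
    set y := Real.sin B
    set p := Real.cos A
    set q := Real.cos B
    set r := Real.sin (π / 3)
    linear_combination (-(x * q + p * y) ^ 2) * h3 + (q ^ 2 - 3 / 4 * (y ^ 2 + q ^ 2)) * eA
      + (1 / 4 - x ^ 2) * eB
  have hc : 0 < Real.cos (A + B - π / 3) :=
    Real.cos_pos_of_mem_Ioo ⟨by linarith [Real.pi_pos], by linarith [Real.pi_pos]⟩
  have hd : Real.cos (A + B - π / 3) < Real.cos (A - B) := by
    rw [← Real.cos_abs (A - B)]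
    apply Real.cos_lt_cos_of_nonneg_of_le_pi (abs_nonneg _) (by linarith [Real.pi_pos])
    rw [abs_lt]
    constructor <;> linarith
  nlinarith [mul_pos hc (sub_pos.2 hd)]

/-- The two outer points across a corner either coincide, forming a rhombus, or the three angles
involved have a large sum. -/
lemma rhombus_or_large (hP : Config P) {c u1 u2 d1 d2 : ℂ} {φ1 φ2 α : ℝ}
    (h1 : Corner P u1 d1 c φ1) (hc : Corner P c u1 u2 α) (h2 : Corner P u2 c d2 φ2)
    (l1 : π / 3 < φ1) (l1' : φ1 < 2 * π / 3) (l2 : π / 3 < φ2) (l2' : φ2 < 2 * π / 3)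
    (s1 : π ≤ α + φ1) (s2 : π ≤ α + φ2) :
    (d1 = d2 ∧ φ1 = φ2 ∧ α + φ1 = π) ∨ 5 * π / 3 < α + φ1 + φ2 := by
  have hpi := Real.pi_pos
  rcases lt_or_ge (5 * π / 3) (α + φ1 + φ2) with h | h
  · exact Or.inr h
  left
  obtain ⟨A, rfl⟩ : ∃ A, φ1 = 2 * A := ⟨φ1 / 2, by ring⟩
  obtain ⟨B, rfl⟩ : ∃ B, φ2 = 2 * B := ⟨φ2 / 2, by ring⟩
  have hd : d1 - d2 = (u1 - c) * ((2 * Complex.I) *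
      (((Real.sin A : ℝ) : ℂ) * cis (-A) + ((Real.sin B : ℝ) : ℂ) * cis (α + B))) := by
    have e1 := h1.rot_neg
    have e2 := h2.rot
    have e3 := hc.rot
    have o1 := one_sub_cis (-A)
    have o2 := one_sub_cis B
    rw [show 2 * -A = -(2 * A) by ring, Real.sin_neg] at o1
    push_cast at o1 o2 ⊢
    rw [cis_add]
    linear_combination e1 - e2 + (u1 - c) * o1 - (u1 - c) * cis α * o2 + (cis (2 * B) - 1) * e3
  have hn : Complex.normSq (d1 - d2) = 4 * (Real.sin A ^ 2 + Real.sin B ^ 2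
      + 2 * Real.sin A * Real.sin B * Real.cos (2 * π - (α + A + B))) := by
    rw [hd, Complex.normSq_mul, normSq_of_mem_nb hc.left, Complex.normSq_mul, normSq_add_cis,
      Complex.normSq_mul, Complex.normSq_I, Real.cos_two_pi_sub]
    rw [show α + B - -A = α + A + B by ring]
    norm_num [Complex.normSq_apply]
  have hsA : 0 < Real.sin A := Real.sin_pos_of_pos_of_lt_pi (by linarith) (by linarith)
  have hsB : 0 < Real.sin B := Real.sin_pos_of_pos_of_lt_pi (by linarith) (by linarith)
  have hcos : Real.cos (2 * π - (α + A + B)) ≤ Real.cos (A + B + π / 3) :=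
    Real.cos_le_cos_of_nonneg_of_le_pi (by linarith) (by linarith) (by linarith)
  have hlt := sin_sq_add_sin_sq_lt (A := A) (B := B) (by linarith) (by linarith) (by linarith)
    (by linarith)
  have hsAB := mul_pos hsA hsB
  have hdd : d1 = d2 := by
    apply eq_of_normSq_lt_one hP (mem_nb.1 h1.left).1 (mem_nb.1 h2.right).1
    rw [hn]
    nlinarith [mul_le_mul_of_nonneg_left hcos hsAB.le]
  rw [hdd, sub_self, map_zero] at hn
  have hcos' : -1 ≤ Real.cos (2 * π - (α + A + B)) := Real.neg_one_le_cos _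
  have hsq : Real.sin A = Real.sin B := by
    nlinarith [mul_nonneg hsAB.le (by linarith : 0 ≤ 1 + Real.cos (2 * π - (α + A + B))),
      sq_nonneg (Real.sin A - Real.sin B)]
  have hAB : A = B := Real.injOn_sin ⟨by linarith, by linarith⟩ ⟨by linarith, by linarith⟩ hsq
  have hone : α + A + B = π := by
    by_contra hne
    have h5 : π < α + A + B := lt_of_le_of_ne (by linarith) (Ne.symm hne)
    have h6 : Real.cos π < Real.cos (2 * π - (α + A + B)) :=
      Real.cos_lt_cos_of_nonneg_of_le_pi (by linarith) le_rfl (by linarith)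
    rw [Real.cos_pi] at h6
    rw [← hsq] at hn
    nlinarith [mul_pos hsA hsA]
  exact ⟨hdd, by rw [hAB], by linarith⟩

/-- Beyond an equilateral triangle `u p q`, next to a corner of angle `b` at `u`, the corner at `p`
is at most `b`. -/
lemma exists_corner_left (hP : Config P) {u y p q : ℂ} {b t : ℝ} (h0 : Corner P u y p b)
    (h1 : Corner P u p q t) (ht : t = π / 3) (hb : b ≠ π / 3) (hp : (nb P p).card = 5) :
    ∃ k l, Corner P p k q l ∧ l ≤ b := by
  obtain ⟨p1, p2, p3, p4, β0, β1, β2, β3, β4, hs⟩ :=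
    exists_star5 (mem_nb.1 h1.left).1 hp (mem_nb_comm h1.mem h1.left)
  obtain ⟨h4, rfl⟩ := side_left hP h1 hs.c4 ht
  have e := wide_right hP hs.c0 h0 hb
  exact ⟨_, _, hs.c3, by linarith [e.2.2.1, hs.c1.ge hP, hs.c2.ge hP, hs.sum]⟩

/-- The mirror image of `exists_corner_left`. -/
lemma exists_corner_right (hP : Config P) {u y p q : ℂ} {b t : ℝ} (h1 : Corner P u p q t)
    (h0 : Corner P u q y b) (ht : t = π / 3) (hb : b ≠ π / 3) (hq : (nb P q).card = 5) :
    ∃ k l, Corner P q p k l ∧ l ≤ b := by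
  obtain ⟨p1, p2, p3, p4, β0, β1, β2, β3, β4, hs⟩ :=
    exists_star5 (mem_nb.1 h1.right).1 hq (mem_nb_comm h1.mem h1.right)
  obtain ⟨h4, rfl⟩ := side_right hP hs.c0 h1 ht
  have e := wide_left hP h0 hs.c4 hb
  exact ⟨_, _, hs.c1, by linarith [e.2.2.1, hs.c2.ge hP, hs.c3.ge hP, hs.sum]⟩

/-- A triangle at `u` between two corners of angle sum less than `π` has a triangle across its
far edge. -/
lemma exists_third (hP : Config P) {u y y' p q : ℂ} {b b' t : ℝ} (h0 : Corner P u y p b)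
    (h1 : Corner P u p q t) (h2 : Corner P u q y' b') (ht : t = π / 3) (hb : b ≠ π / 3)
    (hb' : b' ≠ π / 3) (hlt : b + b' < π) (hp : (nb P p).card = 5) (hq : (nb P q).card = 5) :
    ∃ k, Corner P p k q (π / 3) ∧ Corner P q p k (π / 3) := by
  obtain ⟨k, l, hk, hl⟩ := exists_corner_left hP h0 h1 ht hb hp
  obtain ⟨k', l', hk', hl'⟩ := exists_corner_right hP h1 h2 ht hb' hq
  rcases side hP hk' hk with ⟨rfl, rfl, rfl⟩ | h
  · exact ⟨_, hk, hk'⟩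
  · linarith [h.2.2.1]

/-- Two corners at the base of a triangle with apex of degree five add up to at least `π`. -/
lemma pi_le_add (hP : Config P) {u0 u1 a y y' : ℂ} {b b' t : ℝ} (h0 : Corner P u0 y a b)
    (h1 : Corner P u0 a u1 t) (h2 : Corner P u1 a y' b') (ht : t = π / 3) (hb : b ≠ π / 3)
    (hb' : b' ≠ π / 3) (ha : (nb P a).card = 5) : π ≤ b + b' := by
  obtain ⟨p1, p2, p3, p4, β0, β1, β2, β3, β4, hs⟩ :=
    exists_star5 (mem_nb.1 h1.left).1 ha (mem_nb_comm h1.mem h1.left)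
  obtain ⟨h4, rfl⟩ := side_left hP h1 hs.c4 ht
  have e := wide_right hP hs.c0 h0 hb
  have e' := wide_left hP h2 hs.c3 hb'
  linarith [e.2.2.1, e'.2.2.1, hs.c1.ge hP, hs.c2.ge hP, hs.sum]

/-- The corner of a rhombus `c u1 x u2` at `x`. -/
lemma rhombus_corner (hP : Config P) {c u1 u2 x y : ℂ} {α φ l : ℝ} (hc : Corner P c u1 u2 α)
    (h1 : Corner P u1 x c φ) (hφ : φ ≠ π / 3) (hs : α + φ = π) (hx : Corner P x y u1 l) :
    l = α ∧ y = u2 := by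
  obtain ⟨-, -, -, f⟩ := wide_right hP hc h1 hφ
  have hxe := f hs
  have hu : u2 - x = cis (-α) * (u1 - x) := by
    have e1 := hc.rot_neg
    rw [hxe]
    linear_combination -e1
  have hmem : u2 ∈ nb P x := by
    refine mem_nb.2 ⟨(mem_nb.1 hc.right).1, ?_⟩
    rw [hu, norm_mul, norm_cis, one_mul]
    exact (mem_nb.1 hx.right).2
  obtain ⟨-, -, g, -⟩ := wide_left hP h1 hx hφ
  have hl : l = α := by
    refine le_antisymm ?_ (by linarith)
    by_contra hlt
    push Not at hlt
    exact hx.free_neg hmem hc.pos hlt hu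
  refine ⟨hl, ?_⟩
  have := hx.rot_neg
  rw [hl, ← hu] at this
  exact sub_left_injective this

/-- A vertex `u` of degree five next to `c`, all whose other neighbours have degree five, in the
case where the corners not at `c` are alternately equilateral. -/
structure Arm (P : Finset ℂ) (c u p1 p2 p3 p4 : ℂ) (a0 a1 a2 a3 a4 : ℝ) : Prop extends
    Star5 P u c p1 p2 p3 p4 a0 a1 a2 a3 a4 where
  eq1 : a1 = π / 3
  eq3 : a3 = π / 3
  lt2 : π / 3 < a2
  deg1 : (nb P p1).card = 5
  deg2 : (nb P p2).card = 5
  deg3 : (nb P p3).card = 5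
  deg4 : (nb P p4).card = 5

lemma not_rhombus (hP : Config P) {c u1 u2 x p1 p2 p3 q2 q3 q4 : ℂ}
    {α a0 a1 a2 a3 φ b1 b2 b3 b4 : ℝ}
    (h1 : Arm P c u1 p1 p2 p3 x a0 a1 a2 a3 φ) (h2 : Arm P c u2 x q2 q3 q4 φ b1 b2 b3 b4)
    (ha0 : a0 = π / 3) (hb4 : b4 = π / 3) (hc : Corner P c u1 u2 α) (hs : α + φ = π)
    (hφ : φ ≠ π / 3) : False := by
  have hpi := Real.pi_pos
  have g1 := h1.eq1
  have g3 := h1.eq3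
  have k1 := h2.eq1
  have k3 := h2.eq3
  have s1 := h1.sum
  have s2 := h2.sum
  have ha2 : a2 = α := by linarith
  have hb2 : b2 = α := by linarith
  have hα : π / 3 < α := ha2 ▸ h1.lt2
  have hα' : α < 2 * π / 3 := ha2 ▸ h1.rotate.rotate.lt hP
  obtain ⟨x1, x2, x3, x4, l0, l1, l2, l3, l4, hx⟩ :=
    exists_star5 (mem_nb.1 h1.c3.right).1 h1.deg4 (mem_nb_comm h1.c0.mem h1.c3.right)
  obtain ⟨e0, rfl⟩ := side_right hP hx.c0 h1.c3 g3
  obtain ⟨rfl, rfl⟩ := rhombus_corner hP hc h1.c4 hφ hs hx.c4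
  obtain ⟨e3, rfl⟩ := side_left hP h2.c1 hx.c3 k1
  obtain ⟨k, l, hk, hl⟩ := exists_corner_left hP h1.c2 h1.c3 g3 h1.lt2.ne' h1.deg3
  obtain ⟨k', l', hk', hl'⟩ := exists_corner_right hP h2.c1 h2.c2 k1 h2.lt2.ne' h2.deg2
  have sx := hx.sum
  have hw := cis_third_sq
  have xe : x = x4 + u1 - c := (wide_right hP hc h1.c4 hφ).2.2.2 hs
  have r2 := hc.rot
  have r2' := hc.rot_neg
  have z0 := sub_ne_zero_of_mem_nb hc.left
  have rp1 := h1.c0.rot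
  have rq4 := h2.c4.rot_neg
  have rx1 := hx.c0.rot
  have rx3 := h2.c1.rot
  rw [ha0] at rp1
  rw [hb4, cis_neg_third] at rq4
  rw [e0] at rx1
  rw [k1] at rx3
  rcases side hP hx.c1 hk with ⟨m1, -, -⟩ | ⟨-, -, m1, f1⟩ <;>
    rcases side hP hk' hx.c2 with ⟨-, m2, -⟩ | ⟨-, -, m2, f2⟩
  · linarith
  · have hk'e := f2 (by linarith)
    have rx2 := hx.c1.rot
    rw [m1] at rx2
    refine not_collinear_left hP hx.c0.mem (mem_nb.1 h1.c0.right).1 (mem_nb.1 hk'.right).1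
      (z := cis (π / 3) * cis (π / 3) * (u1 - c))
      (mul_ne_zero (mul_ne_zero (cis_ne_zero _) (cis_ne_zero _)) z0)
      hc.pos (by linarith) ?_ ?_
    · linear_combination rp1 - xe - r2 - (u1 - c) * (cis (π / 3) + cis l4) * (cis (π / 3) + 1) * hw
    · linear_combination -hk'e + rx2 + cis (π / 3) * rx1 + rx3
        + (cis (π / 3) - 1 - cis (π / 3) * cis (π / 3)) * xe
        - cis (π / 3) * cis (π / 3) * r2 - (u1 - c) * hw
  · have hke := f1 (by linarith)
    have rx2 := hx.c2.rot_neg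
    rw [m2, cis_neg_third] at rx2
    refine not_collinear_right hP hx.c0.mem (mem_nb.1 h2.c3.right).1 (mem_nb.1 hk.left).1
      (z := -(cis (π / 3) * (x4 - c))) (neg_ne_zero.2 (mul_ne_zero (cis_ne_zero _)
        (sub_ne_zero_of_mem_nb hc.right))) hc.pos (by linarith) ?_ ?_
    · rw [cis_neg_third]
      linear_combination rq4 - xe - r2' - (x4 - c) * (1 - cis (π / 3) + cis (-l4)) * hw
    · linear_combination hke + rx2 + rx1 + (1 - cis (π / 3)) * rx3
        + (-(1 - cis (π / 3)) ^ 2 - cis (π / 3)) * xe + cis (π / 3) * r2' - (u1 - c) * hw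
  · linarith

lemma Star5.ne {v u0 u1 u2 u3 u4 : ℂ} {a0 a1 a2 a3 a4 : ℝ}
    (h : Star5 P v u0 u1 u2 u3 u4 a0 a1 a2 a3 a4) :
    u1 ≠ u0 ∧ u2 ≠ u0 ∧ u3 ≠ u0 ∧ u4 ≠ u0 := by
  have key : ∀ t w, 0 < t → t < 2 * π → w - v = cis t * (u0 - v) → w ≠ u0 := by
    rintro t w h0 h1 hw rfl
    apply cis_ne_one h0 h1
    exact mul_right_cancel₀ (sub_ne_zero_of_mem_nb h.c0.left) (by rw [one_mul]; exact hw.symm)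
  have r1 := h.c0.rot
  have r2 := h.c1.rot
  have r3 := h.c2.rot
  have r4 := h.c3.rot
  rw [r1, ← mul_assoc, ← cis_add] at r2
  rw [r2, ← mul_assoc, ← cis_add] at r3
  rw [r3, ← mul_assoc, ← cis_add] at r4
  have := h.c0.pos
  have := h.c1.pos
  have := h.c2.pos
  have := h.c3.pos
  have := h.c4.pos
  have := h.sum
  exact ⟨key _ _ (by linarith) (by linarith) r1, key _ _ (by linarith) (by linarith) r2,
    key _ _ (by linarith) (by linarith) r3, key _ _ (by linarith) (by linarith) r4⟩

/-- The neighbour `u` of `c` has degree five, and so have all its other neighbours. -/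
def Good (P : Finset ℂ) (c u : ℂ) : Prop :=
  (nb P u).card = 5 ∧ ∀ w ∈ nb P u, w ≠ c → (nb P w).card = 5

lemma Good.arm_or (hP : Config P) {c u p1 p2 p3 p4 : ℂ} {a0 a1 a2 a3 a4 : ℝ} (hg : Good P c u)
    (h : Star5 P u c p1 p2 p3 p4 a0 a1 a2 a3 a4) :
    Arm P c u p1 p2 p3 p4 a0 a1 a2 a3 a4 ∨
      (a0 = π / 3 ∧ a1 ≠ π / 3 ∧ a3 ≠ π / 3 ∧ a4 = π / 3) := by
  obtain ⟨n1, n2, n3, n4⟩ := h.ne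
  have d1 := hg.2 _ h.c1.left n1
  have d2 := hg.2 _ h.c2.left n2
  have d3 := hg.2 _ h.c3.left n3
  have d4 := hg.2 _ h.c4.left n4
  have m1 := h.third_or_third hP d1
  have m2 := h.rotate.third_or_third hP d2
  have m3 := h.rotate.rotate.third_or_third hP d3
  have m4 := h.rotate.rotate.rotate.third_or_third hP d4
  have e1 := fun x y => not_diamond hP h.rotate x y d1 d2 d3
  have e2 := fun x y => not_diamond hP h.rotate.rotate x y d2 d3 d4
  by_cases h2 : a2 = π / 3
  · right
    tauto
  · left
    exact ⟨h, by tauto, by tauto, h.c2.ne_third_lt hP h2, d1, d2, d3, d4⟩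

lemma Good.exists_arm (hP : Config P) {c t u w s : ℂ} {γ γ' γ'' : ℝ} (h0 : Corner P c t u γ)
    (h1 : Corner P c u w γ') (h2 : Corner P c w s γ'') (hu : Good P c u) (hw : Good P c w) :
    ∃ p1 p2 p3 p4 a0 a1 a2 a3 a4, Arm P c u p1 p2 p3 p4 a0 a1 a2 a3 a4 := by
  obtain ⟨p1, p2, p3, p4, a0, a1, a2, a3, a4, hs⟩ :=
    exists_star5 (mem_nb.1 h1.left).1 hu.1 (mem_nb_comm h1.mem h1.left)
  rcases hu.arm_or hP hs with h | ⟨e0, -, e3, e4⟩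
  · exact ⟨_, _, _, _, _, _, _, _, _, h⟩
  exfalso
  have hγ := (side_left hP hs.c0 h0 e0).1
  obtain ⟨hγ', rfl⟩ := side_right hP h1 hs.c4 e4
  obtain ⟨q1, q2, q3, q4, b0, b1, b2, b3, b4, hs'⟩ :=
    exists_star5 (mem_nb.1 h2.left).1 hw.1 (mem_nb_comm h2.mem h2.left)
  obtain ⟨-, rfl⟩ := side_right hP hs'.c0 h1 hγ'
  rcases hw.arm_or hP hs' with h | ⟨-, -, -, f4⟩
  · exact e3 (side_left hP h.c1 hs.c3 h.eq1).1
  · exact not_three hP h0 h1 h2 hγ hγ' (side_right hP h2 hs'.c4 f4).1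

section Arm

variable {c u u' p1 p2 p3 p4 q1 q2 q3 q4 : ℂ} {γ a0 a1 a2 a3 a4 b0 b1 b2 b3 b4 : ℝ}

lemma Arm.add_eq (h : Arm P c u p1 p2 p3 p4 a0 a1 a2 a3 a4) : a0 + a2 + a4 = 4 * π / 3 := by
  linarith [h.sum, h.eq1, h.eq3]

lemma Arm.link_third (hP : Config P) (h : Arm P c u p1 p2 p3 p4 a0 a1 a2 a3 a4)
    (h' : Arm P c u' q1 q2 q3 q4 b0 b1 b2 b3 b4) (hc : Corner P c u u' γ) (hγ : γ = π / 3) :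
    a4 = π / 3 ∧ b0 = π / 3 ∧ π ≤ a2 + b2 := by
  obtain ⟨e4, rfl⟩ := side_left hP hc h.c4 hγ
  obtain ⟨e0, rfl⟩ := side_right hP h'.c0 hc hγ
  obtain ⟨-, rfl⟩ := side_left hP h'.c1 h.c3 h'.eq1
  exact ⟨e4, e0, pi_le_add hP h.c2 h.c3 h'.c2 h.eq3 h.lt2.ne' h'.lt2.ne' h.deg3⟩

lemma Arm.link_ne_third (hP : Config P) (h : Arm P c u p1 p2 p3 p4 a0 a1 a2 a3 a4)
    (h' : Arm P c u' q1 q2 q3 q4 b0 b1 b2 b3 b4) (hc : Corner P c u u' γ) (hγ : γ ≠ π / 3) :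
    π / 3 < a4 ∧ π / 3 < b0 ∧ π ≤ γ + a4 ∧ π ≤ γ + b0 ∧
      ((p4 = q1 ∧ a4 = b0 ∧ γ + a4 = π) ∨ 5 * π / 3 < γ + a4 + b0) := by
  obtain ⟨-, l1, s1, -⟩ := wide_left hP hc h.c4 hγ
  obtain ⟨l2, -, s2, -⟩ := wide_right hP h'.c0 hc hγ
  rw [add_comm] at s2
  exact ⟨l1, l2, s1, s2, rhombus_or_large hP h.c4 hc h'.c0 l1
    (h.rotate.rotate.rotate.rotate.lt hP) l2 (h'.lt hP) s1 s2⟩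

lemma Arm.not_rhombus_of_add_lt (hP : Config P) (h : Arm P c u p1 p2 p3 p4 a0 a1 a2 a3 a4)
    (h' : Arm P c u' q1 q2 q3 q4 b0 b1 b2 b3 b4) (hc : Corner P c u u' γ) (hγ : γ + a4 = π)
    (ha4 : a4 ≠ π / 3) (hx : p4 = q1) (hab : a4 = b0) (hlt : a2 + a4 < π) (hlt' : b0 + b2 < π) :
    False := by
  subst hx hab
  obtain ⟨x1, x2, x3, x4, l0, l1, l2, l3, l4, hx⟩ :=
    exists_star5 (mem_nb.1 h.c3.right).1 h.deg4 (mem_nb_comm h.c0.mem h.c3.right)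
  obtain ⟨e0, rfl⟩ := side_right hP hx.c0 h.c3 h.eq3
  obtain ⟨rfl, rfl⟩ := rhombus_corner hP hc h.c4 ha4 hγ hx.c4
  obtain ⟨-, rfl⟩ := side_left hP h'.c1 hx.c3 h'.eq1
  obtain ⟨k, -, hk⟩ := exists_third hP h.c2 h.c3 h.c4 h.eq3 h.lt2.ne' ha4 hlt h.deg3 h.deg4
  obtain ⟨k', hk', -⟩ := exists_third hP h'.c0 h'.c1 h'.c2 h'.eq1 ha4 h'.lt2.ne' hlt' h'.deg1
    h'.deg2
  exact not_three hP hx.c0 hx.c1 hx.c2 e0 (hx.c1.unique_right hk).1 (hx.c2.unique_left hk').1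

end Arm

section Wheel

variable {c u0 u1 u2 u3 p1 p2 p3 p4 q1 q2 q3 q4 r1 r2 r3 r4 s1 s2 s3 s4 : ℂ}
  {γ0 γ1 γ2 γ3 a0 a1 a2 a3 a4 b0 b1 b2 b3 b4 d0 d1 d2 d3 d4 e0 e1 e2 e3 e4 : ℝ}

lemma not_wheel_of_none (hP : Config P) (h : Star4 P c u0 u1 u2 u3 γ0 γ1 γ2 γ3)
    (A0 : Arm P c u0 p1 p2 p3 p4 a0 a1 a2 a3 a4) (A1 : Arm P c u1 q1 q2 q3 q4 b0 b1 b2 b3 b4)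
    (A2 : Arm P c u2 r1 r2 r3 r4 d0 d1 d2 d3 d4) (A3 : Arm P c u3 s1 s2 s3 s4 e0 e1 e2 e3 e4)
    (g0 : γ0 ≠ π / 3) (g1 : γ1 ≠ π / 3) (g2 : γ2 ≠ π / 3) (g3 : γ3 ≠ π / 3) : False := by
  obtain ⟨-, -, x0, y0, -⟩ := A0.link_ne_third hP A1 h.c0 g0
  obtain ⟨-, -, x1, y1, -⟩ := A1.link_ne_third hP A2 h.c1 g1
  obtain ⟨-, -, x2, y2, -⟩ := A2.link_ne_third hP A3 h.c2 g2
  obtain ⟨-, -, x3, y3, -⟩ := A3.link_ne_third hP A0 h.c3 g3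
  linarith [h.sum, A0.add_eq, A1.add_eq, A2.add_eq, A3.add_eq, A0.lt2, A1.lt2, A2.lt2, A3.lt2]

lemma not_wheel_of_adjacent (hP : Config P) (h : Star4 P c u0 u1 u2 u3 γ0 γ1 γ2 γ3)
    (A0 : Arm P c u0 p1 p2 p3 p4 a0 a1 a2 a3 a4) (A1 : Arm P c u1 q1 q2 q3 q4 b0 b1 b2 b3 b4)
    (A2 : Arm P c u2 r1 r2 r3 r4 d0 d1 d2 d3 d4) (g0 : γ0 = π / 3) (g1 : γ1 = π / 3) : False := by
  obtain ⟨-, y0, -⟩ := A0.link_third hP A1 h.c0 g0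
  obtain ⟨x1, -, -⟩ := A1.link_third hP A2 h.c1 g1
  exact not_three hP A1.c4 A1.c0 A1.c1 x1 y0 A1.eq1

lemma not_wheel_of_opposite (hP : Config P) (h : Star4 P c u0 u1 u2 u3 γ0 γ1 γ2 γ3)
    (A0 : Arm P c u0 p1 p2 p3 p4 a0 a1 a2 a3 a4) (A1 : Arm P c u1 q1 q2 q3 q4 b0 b1 b2 b3 b4)
    (A2 : Arm P c u2 r1 r2 r3 r4 d0 d1 d2 d3 d4) (A3 : Arm P c u3 s1 s2 s3 s4 e0 e1 e2 e3 e4)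
    (g0 : γ0 = π / 3) (g1 : γ1 ≠ π / 3) (g2 : γ2 = π / 3) (g3 : γ3 ≠ π / 3) : False := by
  obtain ⟨x0, y0, t0⟩ := A0.link_third hP A1 h.c0 g0
  obtain ⟨x2, y2, t2⟩ := A2.link_third hP A3 h.c2 g2
  obtain ⟨l1, -, -, -, x1⟩ := A1.link_ne_third hP A2 h.c1 g1
  obtain ⟨l3, -, -, -, x3⟩ := A3.link_ne_third hP A0 h.c3 g3
  rcases x1 with ⟨rfl, rfl, z1⟩ | x1
  · exact not_rhombus hP A1 A2 y0 x2 h.c1 z1 l1.ne'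
  rcases x3 with ⟨rfl, rfl, z3⟩ | x3
  · exact not_rhombus hP A3 A0 y2 x0 h.c3 z3 l3.ne'
  linarith [h.sum, A0.add_eq, A1.add_eq, A2.add_eq, A3.add_eq]

lemma not_wheel_of_one (hP : Config P) (h : Star4 P c u0 u1 u2 u3 γ0 γ1 γ2 γ3)
    (A0 : Arm P c u0 p1 p2 p3 p4 a0 a1 a2 a3 a4) (A1 : Arm P c u1 q1 q2 q3 q4 b0 b1 b2 b3 b4)
    (A2 : Arm P c u2 r1 r2 r3 r4 d0 d1 d2 d3 d4) (A3 : Arm P c u3 s1 s2 s3 s4 e0 e1 e2 e3 e4)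
    (g0 : γ0 = π / 3) (g1 : γ1 ≠ π / 3) (g2 : γ2 ≠ π / 3) (g3 : γ3 ≠ π / 3) : False := by
  obtain ⟨x0, y0, t0⟩ := A0.link_third hP A1 h.c0 g0
  obtain ⟨l1, m1, -, -, x1⟩ := A1.link_ne_third hP A2 h.c1 g1
  obtain ⟨l2, m2, -, -, x2⟩ := A2.link_ne_third hP A3 h.c2 g2
  obtain ⟨l3, m3, -, -, x3⟩ := A3.link_ne_third hP A0 h.c3 g3
  have z0 := A0.add_eq
  have z1 := A1.add_eq
  have z2 := A2.add_eq
  have z3 := A3.add_eq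
  have hs := h.sum
  have w2 := A2.lt2
  have w3 := A3.lt2
  rcases x2 with ⟨o1, o2, o3⟩ | x2
  · exact A2.not_rhombus_of_add_lt hP A3 h.c2 o3 l2.ne' o1 o2 (by linarith) (by linarith)
  rcases x1 with ⟨-, o1, o1'⟩ | x1 <;> rcases x3 with ⟨-, o3, o3'⟩ | x3 <;> linarith

lemma not_wheel (hP : Config P) (h : Star4 P c u0 u1 u2 u3 γ0 γ1 γ2 γ3)
    (A0 : Arm P c u0 p1 p2 p3 p4 a0 a1 a2 a3 a4) (A1 : Arm P c u1 q1 q2 q3 q4 b0 b1 b2 b3 b4)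
    (A2 : Arm P c u2 r1 r2 r3 r4 d0 d1 d2 d3 d4) (A3 : Arm P c u3 s1 s2 s3 s4 e0 e1 e2 e3 e4) :
    False := by
  have h1 := h.rotate
  have h2 := h1.rotate
  have h3 := h2.rotate
  have n0 := not_wheel_of_none hP h A0 A1 A2 A3
  have d0 := not_wheel_of_adjacent hP h A0 A1 A2
  have d1 := not_wheel_of_adjacent hP h1 A1 A2 A3
  have d2 := not_wheel_of_adjacent hP h2 A2 A3 A0
  have d3 := not_wheel_of_adjacent hP h3 A3 A0 A1
  have o0 := not_wheel_of_opposite hP h A0 A1 A2 A3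
  have o1 := not_wheel_of_opposite hP h1 A1 A2 A3 A0
  have k0 := not_wheel_of_one hP h A0 A1 A2 A3
  have k1 := not_wheel_of_one hP h1 A1 A2 A3 A0
  have k2 := not_wheel_of_one hP h2 A2 A3 A0 A1
  have k3 := not_wheel_of_one hP h3 A3 A0 A1 A2
  by_cases g0 : γ0 = π / 3 <;> by_cases g1 : γ1 = π / 3 <;> by_cases g2 : γ2 = π / 3 <;>
    by_cases g3 : γ3 = π / 3 <;> simp_all

end Wheel

/-- A vertex of degree four has a neighbour that is not good. -/
lemma exists_not_good (hP : Config P) {c : ℂ} (hc : c ∈ P) (h4 : (nb P c).card = 4) :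
    ∃ u ∈ nb P c, ¬ Good P c u := by
  by_contra hall
  push Not at hall
  obtain ⟨u0, hu0⟩ := Finset.card_pos.1 (show 0 < (nb P c).card by omega)
  obtain ⟨u1, u2, u3, γ0, γ1, γ2, γ3, h⟩ := exists_star4 hc h4 hu0
  have g0 := hall _ h.c0.left
  have g1 := hall _ h.c1.left
  have g2 := hall _ h.c2.left
  have g3 := hall _ h.c3.left
  obtain ⟨_, _, _, _, _, _, _, _, _, A0⟩ := Good.exists_arm hP h.c3 h.c0 h.c1 g0 g1
  obtain ⟨_, _, _, _, _, _, _, _, _, A1⟩ := Good.exists_arm hP h.c0 h.c1 h.c2 g1 g2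
  obtain ⟨_, _, _, _, _, _, _, _, _, A2⟩ := Good.exists_arm hP h.c1 h.c2 h.c3 g2 g3
  obtain ⟨_, _, _, _, _, _, _, _, _, A3⟩ := Good.exists_arm hP h.c2 h.c3 h.c0 g3 g0
  exact not_wheel hP h A0 A1 A2 A3

/-- The neighbours of `v` whose degree is not five. -/
noncomputable def low (P : Finset ℂ) (v : ℂ) : Finset ℂ :=
  (nb P v).filter (fun w => (nb P w).card ≠ 5)

lemma mem_low {v w : ℂ} : w ∈ low P v ↔ w ∈ nb P v ∧ (nb P w).card ≠ 5 := by
  simp [low]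

/-- The charge that the vertex `u` draws from each neighbour of degree other than five. -/
noncomputable def charge (P : Finset ℂ) (u : ℂ) : ℝ :=
  if (nb P u).card = 5 then 2 / ((low P u).card : ℝ) else 0

lemma charge_le_two {u v : ℂ} (hv : v ∈ low P u) : charge P u ≤ 2 := by
  unfold charge
  split_ifs
  · have : (1 : ℝ) ≤ (low P u).card := by exact_mod_cast Finset.card_pos.2 ⟨v, hv⟩
    rw [div_le_iff₀ (by linarith)]; linarith
  · norm_num

lemma charge_le_one {u v : ℂ} (hv : v ∈ low P u) (hu : ¬ Good P v u) : charge P u ≤ 1 := by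
  unfold charge
  split_ifs with h
  · have h' : ∃ w ∈ nb P u, w ≠ v ∧ (nb P w).card ≠ 5 := by
      by_contra hne
      push Not at hne
      exact hu ⟨h, hne⟩
    obtain ⟨w, hw, hwv, hw5⟩ := h'
    have : (2 : ℝ) ≤ (low P u).card := by
      exact_mod_cast Finset.one_lt_card.2 ⟨w, mem_low.2 ⟨hw, hw5⟩, v, hv, hwv⟩
    rw [div_le_iff₀ (by linarith)]; linarith
  · norm_num

lemma sum_charge_le (hP : Config P) {v : ℂ} (hv : v ∈ P) (h5 : (nb P v).card ≠ 5) :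
    ∑ u ∈ nb P v, charge P u ≤ 43 - 9 * ((nb P v).card : ℝ) := by
  have hle := card_nb_le_five hP hv
  have hlow : ∀ u ∈ nb P v, v ∈ low P u := fun u hu => mem_low.2 ⟨mem_nb_comm hv hu, h5⟩
  have htwo : ∀ u ∈ nb P v, charge P u ≤ 2 := fun u hu => charge_le_two (hlow u hu)
  rcases Nat.lt_or_ge (nb P v).card 4 with h | h
  · have h1 := Finset.sum_le_card_nsmul _ _ _ htwo
    rw [nsmul_eq_mul] at h1
    have h2 : ((nb P v).card : ℝ) ≤ 3 := by exact_mod_cast Nat.le_of_lt_succ h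
    linarith
  · have h4 : (nb P v).card = 4 := by omega
    obtain ⟨u, hu, hg⟩ := exists_not_good hP hv h4
    have h1 := charge_le_one (hlow u hu) hg
    have h2 := Finset.sum_le_card_nsmul ((nb P v).erase u) (charge P) 2
      fun w hw => htwo w (Finset.mem_of_mem_erase hw)
    rw [nsmul_eq_mul, Finset.card_erase_of_mem hu, h4] at h2
    rw [← Finset.add_sum_erase _ _ hu, h4]
    norm_num at h2 ⊢
    linarith

lemma sum_card_nb_le (hP : Config P) :
    9 * ∑ v ∈ P, ((nb P v).card : ℝ) ≤ 43 * P.card := by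
  have hd : ∑ u ∈ P with (nb P u).card = 5, ∑ _v ∈ low P u, charge P u
      = ∑ v ∈ P with (nb P v).card ≠ 5, ∑ u ∈ nb P v, charge P u := by
    have : ∀ v ∈ P, ∑ u ∈ nb P v, charge P u
        = ∑ u ∈ (nb P v).filter (fun u => (nb P u).card = 5), charge P u := by
      intro v _
      rw [Finset.sum_filter]
      refine Finset.sum_congr rfl fun u _ => ?_
      unfold charge
      split_ifs <;> rfl
    rw [Finset.sum_congr rfl fun v hv => this v (Finset.mem_filter.1 hv).1]
    refine Finset.sum_comm' fun u v => ?_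
    simp only [Finset.mem_filter, mem_low]
    constructor
    · rintro ⟨⟨hu, h5⟩, hv, hv5⟩
      exact ⟨⟨mem_nb_comm hu hv, h5⟩, (mem_nb.1 hv).1, hv5⟩
    · rintro ⟨⟨hu, h5⟩, hv, hv5⟩
      exact ⟨⟨(mem_nb.1 hu).1, h5⟩, mem_nb_comm hv hu, hv5⟩
  have htwo : ∀ u ∈ P.filter (fun u => (nb P u).card = 5), ∑ _v ∈ low P u, charge P u = 2 := by
    intro u hu
    obtain ⟨huP, h5⟩ := Finset.mem_filter.1 hu
    obtain ⟨w, hw, hw5⟩ := exists_nb_card_ne_five hP huP h5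
    have : ((low P u).card : ℝ) ≠ 0 :=
      Nat.cast_ne_zero.2 (Finset.card_pos.2 ⟨w, mem_low.2 ⟨hw, hw5⟩⟩).ne'
    rw [Finset.sum_const, nsmul_eq_mul, charge, if_pos h5]
    field_simp
  rw [Finset.sum_congr rfl htwo] at hd
  have hle : ∑ v ∈ P with (nb P v).card ≠ 5, ∑ u ∈ nb P v, charge P u
      ≤ ∑ v ∈ P with (nb P v).card ≠ 5, (43 - 9 * ((nb P v).card : ℝ)) :=
    Finset.sum_le_sum fun v hv =>
      sum_charge_le hP (Finset.mem_filter.1 hv).1 (Finset.mem_filter.1 hv).2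
  have hfive : ∑ v ∈ P with (nb P v).card = 5, (43 - 9 * ((nb P v).card : ℝ))
      = ∑ v ∈ P with (nb P v).card = 5, (-2 : ℝ) :=
    Finset.sum_congr rfl fun v hv => by rw [(Finset.mem_filter.1 hv).2]; norm_num
  have hsplit := Finset.sum_filter_add_sum_filter_not P (fun v => (nb P v).card = 5)
    (fun v => 43 - 9 * ((nb P v).card : ℝ))
  rw [hfive, Finset.sum_neg_distrib, hd] at hsplit
  have htotal : ∑ v ∈ P, (43 - 9 * ((nb P v).card : ℝ))
      = 43 * P.card - 9 * ∑ v ∈ P, ((nb P v).card : ℝ) := by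
    rw [Finset.sum_sub_distrib, Finset.sum_const, nsmul_eq_mul, ← Finset.mul_sum, mul_comm]
  simp only [ne_eq] at hle hsplit
  linarith

/-- The identification of the Euclidean plane with the complex numbers. -/
noncomputable def toComplex : Pt ≃ₗᵢ[ℝ] ℂ := Complex.orthonormalBasisOneI.repr.symm

lemma config_map {Q : Finset Pt} (hQ : PennyGP Q) :
    Config (Q.map toComplex.toEquiv.toEmbedding) := by
  constructor
  · intro p hp q hq hne
    obtain ⟨p, hp', rfl⟩ := Finset.mem_map.1 hp
    obtain ⟨q, hq', rfl⟩ := Finset.mem_map.1 hq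
    change 1 ≤ ‖toComplex p - toComplex q‖
    rw [← dist_eq_norm, toComplex.dist_map]
    exact hQ.1 p hp' q hq' fun h => hne (by rw [h])
  · intro p hp q hq r hr h1 h2 h3 t ht
    obtain ⟨p, hp', rfl⟩ := Finset.mem_map.1 hp
    obtain ⟨q, hq', rfl⟩ := Finset.mem_map.1 hq
    obtain ⟨r, hr', rfl⟩ := Finset.mem_map.1 hr
    change toComplex q - toComplex p = t * (toComplex r - toComplex p) at ht
    refine hQ.2 p hp' q hq' r hr' (fun h => h1 (by rw [h])) (fun h => h2 (by rw [h]))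
      (fun h => h3 (by rw [h])) ?_
    have ht' : q - p = t • (r - p) := by
      apply toComplex.injective
      rw [map_smul, map_sub, map_sub, ht, Complex.real_smul]
    rw [collinear_iff_of_mem (p₀ := p) (by simp)]
    refine ⟨r - p, ?_⟩
    intro x hx
    simp only [Set.mem_insert_iff, Set.mem_singleton_iff] at hx
    rcases hx with rfl | rfl | rfl
    · exact ⟨0, by simp⟩
    · exact ⟨t, by rw [← ht']; simp⟩
    · exact ⟨1, by simp⟩

/-- The unit distance graph on a finite set of points of the plane. -/
def graph (Q : Finset Pt) : SimpleGraph Q where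
  Adj p q := p ≠ q ∧ dist (p : Pt) q = 1
  symm := ⟨fun p q h => ⟨h.1.symm, by rw [dist_comm]; exact h.2⟩⟩
  loopless := ⟨fun p h => h.1 rfl⟩

open Classical in
lemma degree_graph (Q : Finset Pt) (p : Q) :
    (graph Q).degree p = (nb (Q.map toComplex.toEquiv.toEmbedding) (toComplex p)).card := by
  rw [← SimpleGraph.card_neighborFinset_eq_degree]
  refine Finset.card_bij (fun q _ => toComplex q) ?_ ?_ ?_
  · intro q hq
    rw [SimpleGraph.mem_neighborFinset] at hq
    refine mem_nb.2 ⟨Finset.mem_map_of_mem _ q.2, ?_⟩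
    rw [← dist_eq_norm, toComplex.dist_map, dist_comm]
    exact hq.2
  · intro q _ q' _ h
    exact Subtype.ext (toComplex.injective h)
  · intro z hz
    obtain ⟨hz1, hz2⟩ := mem_nb.1 hz
    obtain ⟨q, hq, rfl⟩ := Finset.mem_map.1 hz1
    change ‖toComplex q - toComplex p‖ = 1 at hz2
    rw [← dist_eq_norm, toComplex.dist_map, dist_comm] at hz2
    refine ⟨⟨q, hq⟩, ?_, rfl⟩
    rw [SimpleGraph.mem_neighborFinset]
    refine ⟨?_, hz2⟩
    rintro rfl
    simp at hz2

open Classical in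
lemma ncard_pennyEdges (Q : Finset Pt) : (pennyEdges Q).ncard = (graph Q).edgeFinset.card := by
  have h : pennyEdges Q = Sym2.map Subtype.val '' (graph Q).edgeSet := by
    ext e
    constructor
    · rintro ⟨p, hp, q, hq, hne, hd, rfl⟩
      exact ⟨s(⟨p, hp⟩, ⟨q, hq⟩), ⟨fun h => hne (congrArg Subtype.val h), hd⟩, rfl⟩
    · rintro ⟨e, he, rfl⟩
      induction e with
      | h p q =>
        exact ⟨p, p.2, q, q.2, fun h => he.1 (Subtype.ext h), he.2, rfl⟩
  rw [h, Set.ncard_image_of_injective _ (Sym2.map.injective Subtype.val_injective),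
    ← SimpleGraph.coe_edgeFinset, Set.ncard_coe_finset]

lemma mul_ncard_pennyEdges_le
    {P : Finset Pt} (hP : PennyGP P) :
    18 * (pennyEdges P).ncard ≤ 43 * P.card := by
  classical
  have h := sum_card_nb_le (config_map hP)
  rw [Finset.sum_map, Finset.card_map] at h
  have h2 := (graph P).sum_degrees_eq_twice_card_edges
  rw [← ncard_pennyEdges, Finset.sum_congr rfl fun p _ => degree_graph P p,
    Finset.sum_coe_sort P fun p =>
      (nb (P.map toComplex.toEquiv.toEmbedding) (toComplex p)).card] at h2
  have h3 : 9 * ∑ p ∈ P, (nb (P.map toComplex.toEquiv.toEmbedding) (toComplex p)).card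
      ≤ 43 * P.card := by exact_mod_cast h
  omega

end PennyGraph

/-- Every penny graph on `n` vertices in general position has at most `43 * n / 18` edges. -/
theorem penny_general_position_edges_le_43_div_18
    (P : Finset Pt) (hP : PennyGP P) :
    18 * (pennyEdges P).ncard ≤ 43 * P.card := by
  exact PennyGraph.mul_ncard_pennyEdges_le hP
end

section
/- Let P be a penny configuration in general position with n points. Then the number of unordered pairs of points of P at distance exactly 1 is at most 12n/5 (equivalently, 5·e ≤ 12·n, where e is the number of edges of the penny graph of P). -/
open Real EuclideanGeometry

/-- The unit vector of direction `θ`. -/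
noncomputable def unitVec (θ : ℝ) : Pt := !₂[cos θ, sin θ]

@[simp] lemma unitVec_zero (θ : ℝ) : unitVec θ 0 = cos θ := by simp [unitVec]

@[simp] lemma unitVec_one (θ : ℝ) : unitVec θ 1 = sin θ := by simp [unitVec]

lemma Pt.ext_coord {p q : Pt} (h0 : p 0 = q 0) (h1 : p 1 = q 1) : p = q := by
  ext i
  fin_cases i
  · exact h0
  · exact h1

lemma Pt.dist_sq (p q : Pt) : dist p q ^ 2 = (p 0 - q 0) ^ 2 + (p 1 - q 1) ^ 2 := by
  rw [EuclideanSpace.dist_eq, Real.sq_sqrt (by positivity)]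
  simp [Fin.sum_univ_two, Real.dist_eq, sq_abs]

lemma unitVec_add_two_pi (θ : ℝ) : unitVec (θ + 2 * π) = unitVec θ :=
  Pt.ext_coord (by simp) (by simp)

lemma unitVec_add_pi (θ : ℝ) : unitVec (θ + π) = -unitVec θ :=
  Pt.ext_coord (by simp) (by simp)

lemma unitVec_ne_zero (θ : ℝ) : unitVec θ ≠ 0 := by
  intro h
  have h0 := congrArg (fun v : Pt => v 0) h
  have h1 := congrArg (fun v : Pt => v 1) h
  simp only [unitVec_zero, unitVec_one, PiLp.zero_apply] at h0 h1
  have := sin_sq_add_cos_sq θ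
  rw [h0, h1] at this
  norm_num at this

/-- The sum of two unit vectors lies on the bisector of their directions. -/
lemma unitVec_add_unitVec (x y : ℝ) :
    unitVec x + unitVec y = (2 * cos ((x - y) / 2)) • unitVec ((x + y) / 2) := by
  apply Pt.ext_coord
  · simp only [PiLp.add_apply, PiLp.smul_apply, unitVec_zero, smul_eq_mul, cos_add_cos]
    ring
  · have := cos_add_cos (x - π / 2) (y - π / 2)
    rw [cos_sub_pi_div_two, cos_sub_pi_div_two,
      show (x - π / 2 + (y - π / 2)) / 2 = (x + y) / 2 - π / 2 by ring,
      show (x - π / 2 - (y - π / 2)) / 2 = (x - y) / 2 by ring, cos_sub_pi_div_two] at this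
    simp only [PiLp.add_apply, PiLp.smul_apply, unitVec_one, smul_eq_mul, this]
    ring

lemma unitVec_sub_pi_div_three_add (θ : ℝ) :
    unitVec θ = unitVec (θ - π / 3) + unitVec (θ + π / 3) := by
  rw [unitVec_add_unitVec, show (θ - π / 3 - (θ + π / 3)) / 2 = -(π / 3) by ring, cos_neg,
    cos_pi_div_three, show (θ - π / 3 + (θ + π / 3)) / 2 = θ by ring]
  norm_num

/-- Every point at distance one from `p` is reached in a direction of a prescribed full turn. -/
lemma exists_unitVec_of_dist_eq_one (θ : ℝ) {p q : Pt} (h : dist p q = 1) :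
    ∃ φ, θ ≤ φ ∧ φ < θ + 2 * π ∧ q = p + unitVec φ := by
  have hsq : (p 0 - q 0) ^ 2 + (p 1 - q 1) ^ 2 = 1 := by rw [← Pt.dist_sq, h]; norm_num
  set z : ℂ := ⟨q 0 - p 0, q 1 - p 1⟩ with hz
  have hn : ‖z‖ = 1 := by
    have : ‖z‖ ^ 2 = 1 := by
      rw [Complex.sq_norm, Complex.normSq_mk]; linarith
    nlinarith [norm_nonneg z]
  have hz0 : z ≠ 0 := by
    intro h0; rw [h0] at hn; simp at hn
  refine ⟨toIcoMod two_pi_pos θ z.arg, left_le_toIcoMod _ _ _, toIcoMod_lt_right _ _ _, ?_⟩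
  have hc := Complex.cos_arg hz0
  have hs := Complex.sin_arg z
  rw [hn, div_one] at hc hs
  simp only [hz] at hc hs
  apply Pt.ext_coord
  · rw [PiLp.add_apply, unitVec_zero, toIcoMod, zsmul_eq_mul, Real.cos_sub_int_mul_two_pi, hc]
    ring
  · rw [PiLp.add_apply, unitVec_one, toIcoMod, zsmul_eq_mul, Real.sin_sub_int_mul_two_pi, hs]
    ring

lemma dist_add_unitVec_sq (p : Pt) (x y : ℝ) :
    dist (p + unitVec x) (p + unitVec y) ^ 2 = 2 - 2 * cos (y - x) := by
  rw [Pt.dist_sq, cos_sub]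
  simp only [PiLp.add_apply, unitVec_zero, unitVec_one]
  linear_combination sin_sq_add_cos_sq x + sin_sq_add_cos_sq y

lemma dist_add_unitVec_add_unitVec_sq (p : Pt) (t x y : ℝ) :
    dist (p + unitVec x) (p + unitVec t + unitVec y) ^ 2 =
      3 - 2 * cos (x - t) + 2 * cos (y - t) - 2 * cos (x - y) := by
  rw [Pt.dist_sq, cos_sub, cos_sub, cos_sub]
  simp only [PiLp.add_apply, unitVec_zero, unitVec_one]
  linear_combination sin_sq_add_cos_sq x + sin_sq_add_cos_sq y + sin_sq_add_cos_sq t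

namespace PennyGP

variable {P : Finset Pt}

/-- No line through a point `p` of the configuration contains two more of its points. -/
lemma not_mem_of_line (hP : PennyGP P) {p v : Pt} (hp : p ∈ P) (hv : v ≠ 0) {s t : ℝ}
    (hs : s ≠ 0) (ht : t ≠ 0) (hst : s ≠ t) (h1 : p + s • v ∈ P) : p + t • v ∉ P := by
  intro h2
  refine hP.2 p hp _ h1 _ h2 (by simp [hs, hv]) (by simp [ht, hv]) ?_ ?_
  · intro h
    exact hst (smul_left_injective ℝ hv (add_left_cancel h))
  · rw [collinear_iff_of_mem (p₀ := p) (by simp)]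
    refine ⟨v, fun q hq => ?_⟩
    rcases hq with rfl | rfl | rfl
    · exact ⟨0, by simp⟩
    · exact ⟨s, by simp [add_comm]⟩
    · exact ⟨t, by simp [add_comm]⟩

lemma opposite_not_mem (hP : PennyGP P) {p : Pt} (hp : p ∈ P) {θ : ℝ}
    (h : p + unitVec θ ∈ P) : p + unitVec (θ + π) ∉ P := by
  have := hP.not_mem_of_line hp (unitVec_ne_zero θ) (s := 1) (t := -1) one_ne_zero (by norm_num)
    (by norm_num) (by simpa using h)
  rwa [neg_one_smul, ← unitVec_add_pi] at this

/-- Directions of two neighbours differ by at least `π / 3`, going either way around. -/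
lemma angle_gap (hP : PennyGP P) {p : Pt} {x y : ℝ} (hx : p + unitVec x ∈ P)
    (hy : p + unitVec y ∈ P) (hxy : x < y) (hyx : y < x + 2 * π) :
    π / 3 ≤ y - x ∧ y - x ≤ 5 * π / 3 := by
  have hπ := pi_pos
  have hsq := dist_add_unitVec_sq p x y
  have hne : p + unitVec x ≠ p + unitVec y := by
    intro h
    rw [h, dist_self] at hsq
    have h1 : cos (y - x) = 1 := by linarith
    rw [Real.cos_eq_one_iff_of_lt_of_lt (by linarith) (by linarith)] at h1
    linarith
  have hd := hP.1 _ hx _ hy hne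
  have hcos : cos (y - x) ≤ cos (π / 3) := by
    rw [cos_pi_div_three]; nlinarith
  constructor
  · by_contra! h
    exact absurd hcos (not_le.2 (cos_lt_cos_of_nonneg_of_le_pi (by linarith) (by linarith) h))
  · by_contra! h
    rw [← Real.cos_two_pi_sub] at hcos
    exact absurd hcos
      (not_le.2 (cos_lt_cos_of_nonneg_of_le_pi (by linarith) (by linarith) (by linarith)))

/-- A unit edge from `p` in direction `θ`, with a further edge at each of its ends on the same
side, making angles `π / 3 + a` and `π / 3 + b` with it: either these close up to an equilateral
triangle, or the angles add up to at least `π`. -/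
lemma eq_zero_or_le_of_edge (hP : PennyGP P) {p : Pt} {θ a b : ℝ} (ha : 0 ≤ a) (hb : 0 ≤ b)
    (h1 : p + unitVec (θ + (π / 3 + a)) ∈ P)
    (h2 : p + unitVec θ + unitVec (θ + (2 * π / 3 - b)) ∈ P) :
    (a = 0 ∧ b = 0) ∨ π / 3 ≤ a + b := by
  by_contra! hcon
  obtain ⟨hne, hlt⟩ := hcon
  have hπ := pi_pos
  have hsq := dist_add_unitVec_add_unitVec_sq p θ (θ + (π / 3 + a)) (θ + (2 * π / 3 - b))
  set C := cos (π / 3 + (a + b) / 2) with hC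
  set k := cos ((a - b) / 2) with hk
  have hform : dist (p + unitVec (θ + (π / 3 + a)))
      (p + unitVec θ + unitVec (θ + (2 * π / 3 - b))) ^ 2 = 1 - 4 * C * k + 4 * C ^ 2 := by
    rw [hsq, show θ + (π / 3 + a) - θ = π / 3 + a by ring,
      show θ + (2 * π / 3 - b) - θ = π - (π / 3 + b) by ring,
      show θ + (π / 3 + a) - (θ + (2 * π / 3 - b)) = 2 * (π / 3 + (a + b) / 2) - π by ring,
      cos_pi_sub, cos_sub_pi, cos_two_mul]
    have := cos_add_cos (π / 3 + a) (π / 3 + b)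
    rw [show (π / 3 + a + (π / 3 + b)) / 2 = π / 3 + (a + b) / 2 by ring,
      show (π / 3 + a - (π / 3 + b)) / 2 = (a - b) / 2 by ring] at this
    linarith
  have hCpos : 0 < C := cos_pos_of_mem_Ioo ⟨by linarith, by linarith⟩
  have hCk : C < k := by
    rw [hk, ← Real.cos_abs ((a - b) / 2)]
    refine cos_lt_cos_of_nonneg_of_le_pi (abs_nonneg _) (by linarith) ?_
    rw [abs_lt]
    constructor <;> linarith
  have hk1 : k ≤ 1 := cos_le_one _
  by_cases heq : p + unitVec (θ + (π / 3 + a)) = p + unitVec θ + unitVec (θ + (2 * π / 3 - b))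
  · rw [heq, dist_self] at hform
    have hC2 : (1 - 2 * C) ^ 2 = 0 := by nlinarith [sq_nonneg (1 - 2 * C)]
    have hC3 : C = cos (π / 3) := by
      rw [cos_pi_div_three]
      have := pow_eq_zero_iff (two_ne_zero) |>.1 hC2
      linarith
    have := injOn_cos ⟨by linarith, by linarith⟩ ⟨by linarith, by linarith⟩ hC3
    exact hne (by linarith) (by linarith)
  · have hd := hP.1 _ h1 _ h2 heq
    nlinarith

end PennyGP

/-- The point `p` has five neighbours in `P`, the first one in direction `θ`, and consecutive
ones enclosing the angles `π / 3 + a`, `π / 3 + b`, `π / 3 + c`, `π / 3 + d`, `π / 3 + f`. -/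
structure FiveStar (P : Finset Pt) (p : Pt) (θ a b c d f : ℝ) : Prop where
  a_nonneg : 0 ≤ a
  b_nonneg : 0 ≤ b
  c_nonneg : 0 ≤ c
  d_nonneg : 0 ≤ d
  f_nonneg : 0 ≤ f
  sum_eq : a + b + c + d + f = π / 3
  mem₀ : p + unitVec θ ∈ P
  mem₁ : p + unitVec (θ + (π / 3 + a)) ∈ P
  mem₂ : p + unitVec (θ + (2 * π / 3 + a + b)) ∈ P
  mem₃ : p + unitVec (θ + (π + a + b + c)) ∈ P
  mem₄ : p + unitVec (θ + (5 * π / 3 - f)) ∈ P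

namespace FiveStar

variable {P : Finset Pt} {p : Pt} {θ a b c d f : ℝ}

lemma rotate (h : FiveStar P p θ a b c d f) :
    FiveStar P p (θ + (π / 3 + a)) b c d f a where
  a_nonneg := h.b_nonneg
  b_nonneg := h.c_nonneg
  c_nonneg := h.d_nonneg
  d_nonneg := h.f_nonneg
  f_nonneg := h.a_nonneg
  sum_eq := by linarith [h.sum_eq]
  mem₀ := h.mem₁
  mem₁ := by convert h.mem₂ using 3; ring
  mem₂ := by convert h.mem₃ using 3; ring
  mem₃ := by convert h.mem₄ using 3; linarith [h.sum_eq]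
  mem₄ := by
    convert h.mem₀ using 2
    rw [← unitVec_add_two_pi θ]
    congr 1
    ring

lemma add_two_pi (h : FiveStar P p θ a b c d f) : FiveStar P p (θ + 2 * π) a b c d f := by
  have := h.rotate.rotate.rotate.rotate.rotate
  convert this using 1
  linarith [h.sum_eq]

lemma ne_zero (hP : PennyGP P) (hp : p ∈ P) (h : FiveStar P p θ a b c d f) :
    0 < a ∨ 0 < b ∨ 0 < c := by
  by_contra! hcon
  obtain ⟨ha, hb, hc⟩ := hcon
  apply hP.opposite_not_mem hp h.mem₀
  convert h.mem₃ using 3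
  linarith [h.a_nonneg, h.b_nonneg, h.c_nonneg]

lemma left_of_edge (hP : PennyGP P) (h : FiveStar P p θ a b c d f) {a' b' c' d' f' : ℝ}
    (h' : FiveStar P (p + unitVec θ) (θ + π) a' b' c' d' f') :
    (a = 0 ∧ f' = 0) ∨ π / 3 ≤ a + f' := by
  refine hP.eq_zero_or_le_of_edge h.a_nonneg h'.f_nonneg h.mem₁ ?_
  convert h'.mem₄ using 2
  rw [← unitVec_add_two_pi]
  congr 1
  ring

lemma right_of_edge (hP : PennyGP P) (h : FiveStar P p θ a b c d f) {a' b' c' d' f' : ℝ}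
    (h' : FiveStar P (p + unitVec θ) (θ + π) a' b' c' d' f') :
    (a' = 0 ∧ f = 0) ∨ π / 3 ≤ a' + f := by
  refine h'.left_of_edge hP ?_ (a' := a) (b' := b) (c' := c) (d' := d) (f' := f)
  convert h.add_two_pi using 1
  · rw [unitVec_add_pi]; abel
  · ring

end FiveStar

/-- The neighbours of `p` in the penny graph of `P`. -/
noncomputable def pennyNeighbors (P : Finset Pt) (p : Pt) : Finset Pt :=
  P.filter fun q => dist p q = 1

lemma add_unitVec_mem_pennyNeighbors {P : Finset Pt} {p : Pt} {θ : ℝ} :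
    p + unitVec θ ∈ pennyNeighbors P p ↔ p + unitVec θ ∈ P := by
  have hd : dist p (p + unitVec θ) = 1 := by
    have : dist p (p + unitVec θ) ^ 2 = 1 := by
      rw [Pt.dist_sq]
      simp [cos_sq_add_sin_sq]
    nlinarith [dist_nonneg (x := p) (y := p + unitVec θ)]
  simp [pennyNeighbors, hd]

namespace PennyGP

variable {P : Finset Pt}

lemma exists_angles (P : Finset Pt) (p : Pt) {θ : ℝ} (hθ : p + unitVec θ ∈ P) :
    ∃ S : Finset ℝ, S.card = (pennyNeighbors P p).card ∧ θ ∈ S ∧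
      ∀ x ∈ S, θ ≤ x ∧ x < θ + 2 * π ∧ p + unitVec x ∈ P := by
  classical
  have hex : ∀ q : Pt, ∃ φ, dist p q = 1 → θ ≤ φ ∧ φ < θ + 2 * π ∧ q = p + unitVec φ := by
    intro q
    by_cases h : dist p q = 1
    · obtain ⟨φ, hφ⟩ := exists_unitVec_of_dist_eq_one θ h
      exact ⟨φ, fun _ => hφ⟩
    · exact ⟨0, fun h' => absurd h' h⟩
  choose g hg using hex
  have hmem : ∀ q ∈ pennyNeighbors P p, q ∈ P ∧ dist p q = 1 := by
    intro q hq
    simpa [pennyNeighbors] using hq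
  refine ⟨(pennyNeighbors P p).image g, Finset.card_image_of_injOn ?_, ?_, ?_⟩
  · intro q hq r hr hqr
    rw [(hg q (hmem q hq).2).2.2, (hg r (hmem r hr).2).2.2, hqr]
  · have hN := add_unitVec_mem_pennyNeighbors.2 hθ
    refine Finset.mem_image.2 ⟨_, hN, ?_⟩
    obtain ⟨h1, h2, h3⟩ := hg _ (hmem _ hN).2
    have hsq := dist_add_unitVec_sq p θ (g (p + unitVec θ))
    rw [← h3, dist_self] at hsq
    have h4 : cos (g (p + unitVec θ) - θ) = 1 := by linarith
    rw [Real.cos_eq_one_iff_of_lt_of_lt (by linarith [pi_pos]) (by linarith)] at h4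
    linarith
  · intro x hx
    obtain ⟨q, hq, rfl⟩ := Finset.mem_image.1 hx
    obtain ⟨h1, h2, h3⟩ := hg q (hmem q hq).2
    exact ⟨h1, h2, h3 ▸ (hmem q hq).1⟩

lemma card_pennyNeighbors_le_five (hP : PennyGP P) {p : Pt} (hp : p ∈ P) :
    (pennyNeighbors P p).card ≤ 5 := by
  by_contra! hcard
  obtain ⟨q, hq⟩ : (pennyNeighbors P p).Nonempty := Finset.card_pos.1 (by omega)
  have hq' : q ∈ P ∧ dist p q = 1 := by simpa [pennyNeighbors] using hq
  obtain ⟨θ, -, -, rfl⟩ := exists_unitVec_of_dist_eq_one 0 hq'.2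
  obtain ⟨S, hS, hθ, hmem⟩ := exists_angles P p hq'.1
  obtain ⟨T, hθT, hTS, hT⟩ := Finset.exists_subsuperset_card_eq
    (Finset.singleton_subset_iff.2 hθ) (n := 6) (by simp) (by omega)
  set g := T.orderEmbOfFin hT
  have hg : ∀ i, θ ≤ g i ∧ g i < θ + 2 * π ∧ p + unitVec (g i) ∈ P :=
    fun i => hmem _ (hTS (T.orderEmbOfFin_mem hT i))
  have hgap : ∀ i j, i < j → π / 3 ≤ g j - g i ∧ g j - g i ≤ 5 * π / 3 := by
    intro i j hij
    exact hP.angle_gap (hg i).2.2 (hg j).2.2 (g.strictMono hij)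
      (by linarith [(hg i).1, (hg j).2.1])
  have h01 := (hgap 0 1 (by decide)).1
  have h12 := (hgap 1 2 (by decide)).1
  have h23 := (hgap 2 3 (by decide)).1
  have h34 := (hgap 3 4 (by decide)).1
  have h45 := (hgap 4 5 (by decide)).1
  have h05 := (hgap 0 5 (by decide)).2
  apply hP.opposite_not_mem hp (hg 0).2.2
  convert (hg 3).2.2 using 3
  linarith

lemma exists_fiveStar (hP : PennyGP P) {p : Pt} {θ : ℝ} (hθ : p + unitVec θ ∈ P)
    (hcard : (pennyNeighbors P p).card = 5) : ∃ a b c d f, FiveStar P p θ a b c d f := by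
  obtain ⟨S, hS, hθS, hmem⟩ := exists_angles P p hθ
  set g := S.orderEmbOfFin (hS.trans hcard)
  have hg : ∀ i, θ ≤ g i ∧ g i < θ + 2 * π ∧ p + unitVec (g i) ∈ P :=
    fun i => hmem _ (S.orderEmbOfFin_mem _ i)
  have hgap : ∀ i j, i < j → π / 3 ≤ g j - g i ∧ g j - g i ≤ 5 * π / 3 := by
    intro i j hij
    exact hP.angle_gap (hg i).2.2 (hg j).2.2 (g.strictMono hij)
      (by linarith [(hg i).1, (hg j).2.1])
  have h0 : g 0 = θ := by
    obtain ⟨i, hi⟩ : θ ∈ Set.range g := by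
      rw [Finset.range_orderEmbOfFin]; exact hθS
    apply le_antisymm _ (hg 0).1
    calc g 0 ≤ g i := g.monotone (Fin.zero_le i)
      _ = θ := hi
  have h01 := (hgap 0 1 (by decide)).1
  have h12 := (hgap 1 2 (by decide)).1
  have h23 := (hgap 2 3 (by decide)).1
  have h34 := (hgap 3 4 (by decide)).1
  have h04 := (hgap 0 4 (by decide)).2
  refine ⟨g 1 - g 0 - π / 3, g 2 - g 1 - π / 3, g 3 - g 2 - π / 3, g 4 - g 3 - π / 3,
    5 * π / 3 - (g 4 - g 0), by linarith, by linarith, by linarith, by linarith, by linarith,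
    by ring, hθ, ?_, ?_, ?_, ?_⟩
  · convert (hg 1).2.2 using 3; linarith
  · convert (hg 2).2.2 using 3; linarith
  · convert (hg 3).2.2 using 3; linarith
  · convert (hg 4).2.2 using 3; linarith

lemma exists_fiveStar_of_adj (hP : PennyGP P) {p : Pt} (hp : p ∈ P)
    (h5 : ∀ q ∈ pennyNeighbors P p, (pennyNeighbors P q).card = 5) {θ : ℝ}
    (hθ : p + unitVec θ ∈ P) :
    ∃ a b c d f, FiveStar P (p + unitVec θ) (θ + π) a b c d f := by
  refine hP.exists_fiveStar ?_ (h5 _ (add_unitVec_mem_pennyNeighbors.2 hθ))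
  rw [unitVec_add_pi]
  simpa using hp

/-- Around a point all of whose neighbours have degree five, one of any two consecutive angles
is `π / 3`. -/
lemma eq_zero_or_eq_zero (hP : PennyGP P) {p : Pt} (hp : p ∈ P)
    (h5 : ∀ q ∈ pennyNeighbors P p, (pennyNeighbors P q).card = 5) {θ a b c d f : ℝ}
    (h : FiveStar P p θ a b c d f) : a = 0 ∨ f = 0 := by
  obtain ⟨a', b', c', d', f', h'⟩ := hP.exists_fiveStar_of_adj hp h5 h.mem₀
  have hl := h.left_of_edge hP h'
  have hr := h.right_of_edge hP h'
  have hz := h.rotate.ne_zero hP hp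
  obtain ⟨_, _, _, _, _, hs, _⟩ := h
  obtain ⟨_, _, _, _, _, hs', _⟩ := h'
  grind

lemma exists_fiveStar_alternating (hP : PennyGP P) {p : Pt} (hp : p ∈ P)
    (h5 : ∀ q ∈ pennyNeighbors P p, (pennyNeighbors P q).card = 5)
    (hcard : (pennyNeighbors P p).card = 5) :
    ∃ θ x y, 0 < x ∧ 0 < y ∧ FiveStar P p θ x 0 y 0 0 := by
  obtain ⟨q, hq⟩ : (pennyNeighbors P p).Nonempty := Finset.card_pos.1 (by omega)
  have hq' : q ∈ P ∧ dist p q = 1 := by simpa [pennyNeighbors] using hq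
  obtain ⟨θ, -, -, rfl⟩ := exists_unitVec_of_dist_eq_one 0 hq'.2
  obtain ⟨a, b, c, d, f, h₀⟩ := hP.exists_fiveStar hq'.1 hcard
  have h₁ := h₀.rotate
  have h₂ := h₁.rotate
  have h₃ := h₂.rotate
  have h₄ := h₃.rotate
  have z₀ := hP.eq_zero_or_eq_zero hp h5 h₀
  have z₁ := hP.eq_zero_or_eq_zero hp h5 h₁
  have z₂ := hP.eq_zero_or_eq_zero hp h5 h₂
  have z₃ := hP.eq_zero_or_eq_zero hp h5 h₃
  have z₄ := hP.eq_zero_or_eq_zero hp h5 h₄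
  have n₀ := h₀.ne_zero hP hp
  have n₁ := h₁.ne_zero hP hp
  have n₂ := h₂.ne_zero hP hp
  have n₃ := h₃.ne_zero hP hp
  have n₄ := h₄.ne_zero hP hp
  have key : (0 < a ∧ b = 0 ∧ 0 < c ∧ d = 0 ∧ f = 0) ∨
      (0 < b ∧ c = 0 ∧ 0 < d ∧ f = 0 ∧ a = 0) ∨ (0 < c ∧ d = 0 ∧ 0 < f ∧ a = 0 ∧ b = 0) ∨
      (0 < d ∧ f = 0 ∧ 0 < a ∧ b = 0 ∧ c = 0) ∨ (0 < f ∧ a = 0 ∧ 0 < b ∧ c = 0 ∧ d = 0) := by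
    have ha := h₀.a_nonneg.eq_or_lt'
    have hb := h₀.b_nonneg.eq_or_lt'
    have hc := h₀.c_nonneg.eq_or_lt'
    have hd := h₀.d_nonneg.eq_or_lt'
    have hf := h₀.f_nonneg.eq_or_lt'
    clear h₀ h₁ h₂ h₃ h₄
    rcases ha with ha | ha <;> rcases hb with hb | hb <;> rcases hc with hc | hc <;>
      rcases hd with hd | hd <;> rcases hf with hf | hf <;> grind
  rcases key with ⟨k, rfl, k', rfl, rfl⟩ | ⟨k, rfl, k', rfl, rfl⟩ | ⟨k, rfl, k', rfl, rfl⟩ |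
    ⟨k, rfl, k', rfl, rfl⟩ | ⟨k, rfl, k', rfl, rfl⟩
  exacts [⟨_, _, _, k, k', h₀⟩, ⟨_, _, _, k, k', h₁⟩, ⟨_, _, _, k, k', h₂⟩,
    ⟨_, _, _, k, k', h₃⟩, ⟨_, _, _, k, k', h₄⟩]

/-- Not all neighbours of a point of degree five have degree five. -/
lemma exists_neighbor_card_ne_five (hP : PennyGP P) {p : Pt} (hp : p ∈ P)
    (hcard : (pennyNeighbors P p).card = 5) :
    ∃ q ∈ pennyNeighbors P p, (pennyNeighbors P q).card ≠ 5 := by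
  by_contra! h5
  have hπ := pi_pos
  obtain ⟨θ, x, y, hx, hy, h₁⟩ := hP.exists_fiveStar_alternating hp h5 hcard
  have hxy : x + y = π / 3 := by linarith [h₁.sum_eq]
  have h₄ : FiveStar P p (θ - 2 * π / 3 + 2 * π) 0 0 x 0 y := by
    convert h₁.rotate.rotate.rotate using 1; linarith
  have h₅ : FiveStar P p (θ - π / 3 + 2 * π) 0 x 0 y 0 := by
    convert h₄.rotate using 1; ring
  have m₄ : p + unitVec (θ - 2 * π / 3) ∈ P := by simpa only [unitVec_add_two_pi] using h₄.mem₀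
  have m₅ : p + unitVec (θ - π / 3) ∈ P := by simpa only [unitVec_add_two_pi] using h₅.mem₀
  obtain ⟨b₁, b₂, b₃, b₄, b₅, hb⟩ := hP.exists_fiveStar_of_adj hp h5 h₁.mem₀
  obtain ⟨c₁, c₂, c₃, c₄, c₅, hc⟩ := hP.exists_fiveStar_of_adj hp h5 h₅.mem₀
  obtain ⟨d₁, d₂, d₃, d₄, d₅, hd⟩ := hP.exists_fiveStar_of_adj hp h5 h₄.mem₀
  have lb := h₁.left_of_edge hP hb
  have rb := h₁.right_of_edge hP hb
  have lc := h₅.left_of_edge hP hc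
  have rc := h₅.right_of_edge hP hc
  have ld := h₄.left_of_edge hP hd
  have rd := h₄.right_of_edge hP hd
  rw [unitVec_add_two_pi] at hc hd
  have hq : p + unitVec (θ - π / 3) ∈ P := m₅
  have nc₁ := hc.rotate.ne_zero hP hq
  have nc₂ := hc.rotate.rotate.ne_zero hP hq
  have nc₃ := hc.rotate.rotate.rotate.ne_zero hP hq
  have nc₄ := hc.rotate.rotate.rotate.rotate.ne_zero hP hq
  have sb := hb.sum_eq
  have sc := hc.sum_eq
  have sd := hd.sum_eq
  have hb₁ : b₁ = 0 := by
    have := hb.a_nonneg; have := hb.b_nonneg; have := hb.c_nonneg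
    have := hb.d_nonneg; have := hb.f_nonneg
    grind
  have hd₅ : d₅ = 0 := by
    have := hd.a_nonneg; have := hd.b_nonneg; have := hd.c_nonneg
    have := hd.d_nonneg; have := hd.f_nonneg
    grind
  have hc₁₅ : c₁ = 0 ∧ c₅ = 0 := by
    have := hc.a_nonneg; have := hc.b_nonneg; have := hc.c_nonneg
    have := hc.d_nonneg; have := hc.f_nonneg
    grind
  obtain ⟨hc₁, hc₅⟩ := hc₁₅
  subst hb₁ hd₅ hc₁ hc₅
  have e₄₅ : (c₂ = 0 ∧ d₄ = 0) ∨ π / 3 ≤ c₂ + d₄ := by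
    refine hc.rotate.left_of_edge hP (a' := 0) (b' := d₁) (c' := d₂) (d' := d₃) (f' := d₄) ?_
    convert hd.rotate.rotate.rotate.rotate using 1
    · rw [add_assoc, show θ - π / 3 + 2 * π + π + (π / 3 + 0) = θ + π + 2 * π by ring,
        unitVec_add_two_pi, unitVec_sub_pi_div_three_add (θ - π / 3), unitVec_add_pi]
      rw [show θ - π / 3 - π / 3 = θ - 2 * π / 3 by ring, sub_add_cancel]
      abel
    · linarith
  have e₁₅ : (b₂ = 0 ∧ c₄ = 0) ∨ π / 3 ≤ b₂ + c₄ := by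
    refine hc.rotate.rotate.rotate.rotate.right_of_edge hP
      (a' := b₂) (b' := b₃) (c' := b₄) (d' := b₅) (f' := 0) ?_
    convert hb.rotate.add_two_pi.add_two_pi using 1
    · rw [add_assoc, show θ - π / 3 + 2 * π + π + (π / 3 + 0) + (π / 3 + c₂) + (π / 3 + c₃) +
        (π / 3 + c₄) = θ + π / 3 + 2 * π + 2 * π by linarith, unitVec_add_two_pi,
        unitVec_add_two_pi, ← unitVec_sub_pi_div_three_add]
    · linarith
  have hfin : d₁ = x ∧ b₂ = x ∧ b₃ = 0 := by
    have := hb.b_nonneg; have := hb.c_nonneg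
    have := hb.d_nonneg; have := hb.f_nonneg
    have := hc.b_nonneg; have := hc.c_nonneg; have := hc.d_nonneg
    have := hd.a_nonneg; have := hd.b_nonneg; have := hd.c_nonneg; have := hd.d_nonneg
    have hc₂ : 0 < c₂ := by grind
    have hc₄ : 0 < c₄ := by grind
    have q₁ : π / 3 ≤ c₂ + d₄ := by grind
    have q₂ : π / 3 ≤ b₂ + c₄ := by grind
    have q₃ : π / 3 ≤ x + b₅ := by grind
    have q₄ : π / 3 ≤ d₁ + y := by grind
    refine ⟨?_, ?_, ?_⟩ <;> linarith
  obtain ⟨rfl, rfl, rfl⟩ := hfin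
  have hw : p + (2 * cos (2 * π / 3 + b₂ / 2)) • unitVec (θ + b₂ / 2) ∈ P := by
    convert hd.mem₁ using 1
    rw [add_assoc, show θ - 2 * π / 3 + 2 * π + π + (π / 3 + b₂) = θ + 2 * π / 3 + b₂ + 2 * π by
      ring, unitVec_add_two_pi, add_comm (unitVec _), unitVec_add_unitVec]
    congr 4 <;> ring
  have hz : p + (2 * cos (b₂ / 2)) • unitVec (θ + b₂ / 2) ∈ P := by
    convert hb.mem₃ using 1
    rw [add_assoc, show θ + π + (π + 0 + b₂ + 0) = θ + b₂ + 2 * π by ring,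
      unitVec_add_two_pi, add_comm (unitVec _), unitVec_add_unitVec]
    congr 4 <;> ring
  have hneg : cos (2 * π / 3 + b₂ / 2) < 0 :=
    cos_neg_of_pi_div_two_lt_of_lt (by linarith) (by linarith)
  have hpos : 0 < cos (b₂ / 2) := cos_pos_of_mem_Ioo ⟨by linarith, by linarith⟩
  exact hP.not_mem_of_line hp (unitVec_ne_zero _) (by linarith) (by linarith) (by linarith) hw hz

/-- The degree sum of a penny graph in general position. -/
lemma sum_card_pennyNeighbors_le (hP : PennyGP P) :
    5 * ∑ p ∈ P, (pennyNeighbors P p).card ≤ 24 * P.card := by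
  classical
  set H := P.filter fun p => (pennyNeighbors P p).card = 5 with hH
  set L := P.filter fun p => ¬ (pennyNeighbors P p).card = 5 with hL
  have hsub : H ⊆ L.biUnion (pennyNeighbors P) := by
    intro p hp
    obtain ⟨hpP, hp5⟩ := Finset.mem_filter.1 hp
    obtain ⟨q, hq, hq5⟩ := hP.exists_neighbor_card_ne_five hpP hp5
    obtain ⟨hqP, hd⟩ := Finset.mem_filter.1 hq
    exact Finset.mem_biUnion.2 ⟨q, Finset.mem_filter.2 ⟨hqP, hq5⟩,
      Finset.mem_filter.2 ⟨hpP, by rwa [dist_comm]⟩⟩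
  have hHL : H.card ≤ ∑ q ∈ L, (pennyNeighbors P q).card :=
    (Finset.card_le_card hsub).trans Finset.card_biUnion_le
  have hLle : ∑ q ∈ L, (pennyNeighbors P q).card ≤ ∑ q ∈ L, 4 := by
    refine Finset.sum_le_sum fun q hq => ?_
    obtain ⟨hqP, hq5⟩ := Finset.mem_filter.1 hq
    have := hP.card_pennyNeighbors_le_five hqP
    omega
  have hHsum : ∑ q ∈ H, (pennyNeighbors P q).card = ∑ q ∈ H, 5 :=
    Finset.sum_congr rfl fun q hq => (Finset.mem_filter.1 hq).2
  have hsplit : ∑ q ∈ H, (pennyNeighbors P q).card + ∑ q ∈ L, (pennyNeighbors P q).card =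
      ∑ q ∈ P, (pennyNeighbors P q).card := Finset.sum_filter_add_sum_filter_not _ _ _
  have hcard : H.card + L.card = P.card := Finset.card_filter_add_card_filter_not _
  rw [Finset.sum_const, smul_eq_mul] at hLle hHsum
  omega

end PennyGP

/-- Every edge is counted from both of its ends in the degree sum. -/
lemma two_mul_ncard_pennyEdges_le (P : Finset Pt) :
    2 * (pennyEdges P).ncard ≤ ∑ p ∈ P, (pennyNeighbors P p).card := by
  classical
  set A := (P ×ˢ P).filter fun z => dist z.1 z.2 = 1 with hA
  have hAcard : A.card = ∑ p ∈ P, (pennyNeighbors P p).card := by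
    rw [hA, Finset.card_filter, Finset.sum_product]
    simp only [pennyNeighbors, Finset.card_filter]
  have hedges : pennyEdges P = ↑(A.image fun z => s(z.1, z.2)) := by
    ext e
    simp only [pennyEdges, Set.mem_ofPred_eq, Finset.coe_image, Set.mem_image, Finset.mem_coe, hA,
      Finset.mem_filter, Finset.mem_product]
    constructor
    · rintro ⟨p, hp, q, hq, -, hd, rfl⟩
      exact ⟨(p, q), ⟨⟨hp, hq⟩, hd⟩, rfl⟩
    · rintro ⟨⟨p, q⟩, ⟨⟨hp, hq⟩, hd⟩, rfl⟩
      refine ⟨p, hp, q, hq, ?_, hd, rfl⟩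
      rintro rfl
      simp at hd
  rw [hedges, Set.ncard_coe_finset, ← hAcard]
  refine Finset.mul_card_image_le_card A 2 fun e he => ?_
  obtain ⟨⟨p, q⟩, hpq, rfl⟩ := Finset.mem_image.1 he
  have hpq' : (p ∈ P ∧ q ∈ P) ∧ dist p q = 1 := by simpa [hA] using hpq
  have hne : p ≠ q := by
    rintro rfl
    simp at hpq'
  have hsub : {(p, q), (q, p)} ⊆ A.filter fun z => s(z.1, z.2) = s(p, q) := by
    intro z hz
    rcases Finset.mem_insert.1 hz with rfl | hz
    · exact Finset.mem_filter.2 ⟨hpq, rfl⟩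
    · rw [Finset.mem_singleton.1 hz]
      simp [hA, hpq', dist_comm q p]
  calc 2 = ({(p, q), (q, p)} : Finset (Pt × Pt)).card := by
        rw [Finset.card_pair (by simp [hne])]
    _ ≤ _ := Finset.card_le_card hsub

/-- Every penny graph on `n` vertices in general position has at most `12n/5` edges. -/
theorem penny_general_position_edges_le_12_div_5
    (P : Finset Pt) (hP : PennyGP P) :
    5 * (pennyEdges P).ncard ≤ 12 * P.card := by
  have h1 := two_mul_ncard_pennyEdges_le P
  have h2 := hP.sum_card_pennyNeighbors_le
  omega
end

section
/- Let P be a penny configuration in general position, let L, U, R, D ∈ P form a kernel, and let L₂, U₁ ∈ P be points with L₂, U₁ ∉ {L,U,R,D}, dist(L,L₂) = 1, dist(U,U₁) = 1, and dist(L₂,U₁) = 1. Then no point of P is at distance exactly 1 from both L₂ and U₁; in particular, at least one of L₂, U₁ has degree at most 4. -/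
open Real EuclideanGeometry

/-- The degree of a point `A` in the penny graph of `P`: the number of points of `P`
at distance exactly 1 from `A`. -/
noncomputable def deg (P : Finset Pt) (A : Pt) : ℕ :=
  {q : Pt | q ∈ P ∧ dist A q = 1}.ncard

/-- A kernel: four distinct points of `P`, each of degree 5, with the five unit
distances `LU`, `UR`, `RD`, `DL`, `LR`. -/
def IsKernel (P : Finset Pt) (L U R D : Pt) : Prop :=
  L ∈ P ∧ U ∈ P ∧ R ∈ P ∧ D ∈ P ∧
  List.Pairwise (· ≠ ·) [L, U, R, D] ∧
  deg P L = 5 ∧ deg P U = 5 ∧ deg P R = 5 ∧ deg P D = 5 ∧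
  dist L U = 1 ∧ dist U R = 1 ∧ dist R D = 1 ∧ dist D L = 1 ∧ dist L R = 1

/-- A point belongs to a kernel if it is one of the four points of some kernel of `P`. -/
def InKernel (P : Finset Pt) (X : Pt) : Prop :=
  ∃ L U R D : Pt, IsKernel P L U R D ∧ X ∈ ({L, U, R, D} : Set Pt)

/-- The unit complex number at angle `t * 60°`. -/
noncomputable def sextant (t : ℝ) : ℂ := Complex.exp ((t * (π / 3) : ℝ) * Complex.I)

lemma sextant_re (t : ℝ) : (sextant t).re = cos (t * (π / 3)) := Complex.exp_ofReal_mul_I_re _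

lemma sextant_im (t : ℝ) : (sextant t).im = sin (t * (π / 3)) := Complex.exp_ofReal_mul_I_im _

lemma norm_sextant (t : ℝ) : ‖sextant t‖ = 1 := Complex.norm_exp_ofReal_mul_I _

lemma sextant_add (s t : ℝ) : sextant (s + t) = sextant s * sextant t := by
  rw [sextant, sextant, sextant, ← Complex.exp_add]
  congr 1
  push_cast
  ring

lemma sextant_zero : sextant 0 = 1 := by simp [sextant]

lemma sextant_three : sextant 3 = -1 := by
  rw [sextant, show (3 : ℝ) * (π / 3) = π by ring, Complex.exp_pi_mul_I]

lemma sextant_add_three (t : ℝ) : sextant (t + 3) = -sextant t := by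
  rw [sextant_add, sextant_three, mul_neg_one]

lemma sextant_add_six (t : ℝ) : sextant (t + 6) = sextant t := by
  rw [show t + 6 = t + 3 + 3 by ring, sextant_add_three, sextant_add_three, neg_neg]

lemma sextant_sub_six (t : ℝ) : sextant (t - 6) = sextant t := by
  rw [← sextant_add_six, sub_add_cancel]

lemma sextant_one_re : (sextant 1).re = 1 / 2 := by
  rw [sextant_re, one_mul, cos_pi_div_three]

lemma sextant_one_im : (sextant 1).im = √3 / 2 := by
  rw [sextant_im, one_mul, sin_pi_div_three]

lemma sextant_one_sq : sextant 1 * sextant 1 = sextant 1 - 1 := by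
  have h : √3 * √3 = 3 := mul_self_sqrt (by norm_num)
  apply Complex.ext
  · rw [Complex.mul_re, sextant_one_re, sextant_one_im, Complex.sub_re, sextant_one_re,
      Complex.one_re]
    linarith
  · rw [Complex.mul_im, sextant_one_re, sextant_one_im, Complex.sub_im, sextant_one_im,
      Complex.one_im]
    ring

lemma sextant_two : sextant 2 = sextant 1 - 1 := by
  rw [← sextant_one_sq, ← sextant_add]; norm_num

lemma sextant_four : sextant 4 = -sextant 1 := by
  rw [← sextant_add_three]; norm_num

lemma sextant_five : sextant 5 = 1 - sextant 1 := by
  rw [show (5 : ℝ) = 2 + 3 by norm_num, sextant_add_three, sextant_two, neg_sub]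

lemma norm_sq_eq_re_im (z : ℂ) : ‖z‖ ^ 2 = z.re ^ 2 + z.im ^ 2 := by
  rw [Complex.sq_norm, Complex.normSq_apply]; ring

lemma norm_sextant_sub_sq (s t : ℝ) :
    ‖sextant s - sextant t‖ ^ 2 = 2 - 2 * cos ((t - s) * (π / 3)) := by
  rw [norm_sq_eq_re_im, Complex.sub_re, Complex.sub_im, sextant_re, sextant_re, sextant_im,
    sextant_im, sub_mul, cos_sub]
  linear_combination sin_sq_add_cos_sq (s * (π / 3)) + sin_sq_add_cos_sq (t * (π / 3))

/-- Unit vectors whose angle is strictly less than `60°` are at distance less than `1`. -/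
lemma norm_sextant_sub_lt_one {s t : ℝ} (h : s < t) (h' : t < s + 1) :
    ‖sextant s - sextant t‖ < 1 := by
  have hc : cos (1 * (π / 3)) < cos ((t - s) * (π / 3)) := by
    apply cos_lt_cos_of_nonneg_of_le_pi <;> nlinarith [pi_pos]
  rw [one_mul, cos_pi_div_three] at hc
  have := norm_sextant_sub_sq s t
  nlinarith [norm_nonneg (sextant s - sextant t)]

lemma sextant_ne {s t : ℝ} (h : s < t) (h' : t < s + 6) : sextant s ≠ sextant t := by
  intro he
  have hs := norm_sextant_sub_sq s t
  rw [he, sub_self, norm_zero] at hs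
  have hc : cos ((t - s) * (π / 3)) = 1 := by linarith
  rw [cos_eq_one_iff_of_lt_of_lt] at hc <;> nlinarith [pi_pos]

lemma eq_one_of_norm_sextant_sub_one {p : ℝ} (h0 : 0 < p) (h3 : p ≤ 3)
    (h : ‖sextant p - 1‖ = 1) : p = 1 := by
  have hs := norm_sextant_sub_sq p 0
  rw [sextant_zero, h, zero_sub, neg_mul, cos_neg] at hs
  have hc : cos (p * (π / 3)) = cos (1 * (π / 3)) := by
    rw [one_mul, cos_pi_div_three]; linarith
  have := injOn_cos ⟨by positivity, by nlinarith [pi_pos]⟩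
    ⟨by positivity, by nlinarith [pi_pos]⟩ hc
  nlinarith [pi_pos]

lemma exists_sextant {z : ℂ} (hz : ‖z‖ = 1) (a : ℝ) :
    ∃ t, a ≤ t ∧ t < a + 6 ∧ sextant t = z := by
  have hpi := pi_pos
  have h6 : (0 : ℝ) < 6 := by norm_num
  have hex : sextant (Complex.arg z / (π / 3)) = z := by
    rw [sextant, div_mul_cancel₀ _ (by positivity)]
    simpa [hz] using Complex.norm_mul_exp_arg_mul_I z
  have hper : Function.Periodic sextant 6 := sextant_add_six
  obtain ⟨t, ht, he⟩ := hper.exists_mem_Ico h6 (Complex.arg z / (π / 3)) a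
  exact ⟨t, ht.1, ht.2, he ▸ hex⟩

/-- A closing side of a quadrilateral with three unit sides whose two base angles
sum to less than `180°` is shorter than `1`. -/
lemma norm_quadrilateral_lt_one {p q : ℝ} (h0 : 0 < p) (hpq : p < q) (h3 : q < 3) :
    ‖sextant p - (1 + sextant q)‖ < 1 := by
  have hpi := pi_pos
  set x := p * (π / 6) with hx
  set y := q * (π / 6) with hy
  have hp : p * (π / 3) = 2 * x := by rw [hx]; ring
  have hq : q * (π / 3) = 2 * y := by rw [hy]; ring
  have hsq : ‖sextant p - (1 + sextant q)‖ ^ 2 = 1 - 8 * (sin (y - x) * (cos y * sin x)) := by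
    rw [norm_sq_eq_re_im, Complex.sub_re, Complex.sub_im, Complex.add_re, Complex.add_im,
      sextant_re, sextant_re, sextant_im, sextant_im, Complex.one_re, Complex.one_im, hp, hq,
      cos_two_mul, cos_two_mul, sin_two_mul, sin_two_mul, sin_sub]
    have h1 := sin_sq_add_cos_sq x
    have h2 := sin_sq_add_cos_sq y
    have h1' : sin x ^ 2 = 1 - cos x ^ 2 := by linarith
    have h2' : sin y ^ 2 = 1 - cos y ^ 2 := by linarith
    ring_nf
    rw [h1', h2']
    ring
  have hs : 0 < sin (y - x) := sin_pos_of_pos_of_lt_pi (by nlinarith) (by nlinarith)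
  have hc : 0 < cos y := cos_pos_of_mem_Ioo ⟨by nlinarith, by nlinarith⟩
  have hsx : 0 < sin x := sin_pos_of_pos_of_lt_pi (by nlinarith) (by nlinarith)
  have := mul_pos hs (mul_pos hc hsx)
  nlinarith [norm_nonneg (sextant p - (1 + sextant q))]

/-- Four unit sides form a rhombus: if `s` is at unit distance from two distinct unit
vectors and `s ≠ 0`, then `s` is their sum. -/
lemma eq_add_of_norm_eq_one {a b s : ℂ} (ha : ‖a‖ = 1) (hb : ‖b‖ = 1) (hab : a ≠ b)
    (hs : s ≠ 0) (hsa : ‖s - a‖ = 1) (hsb : ‖s - b‖ = 1) : s = a + b := by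
  have key : ∀ z : ℂ, ‖z‖ = 1 → z * starRingEnd ℂ z = 1 := fun z hz => by
    rw [Complex.mul_conj, Complex.normSq_eq_norm_sq, hz]; norm_num
  have h1 := key a ha
  have h2 := key b hb
  have h3 := key _ hsa
  have h4 := key _ hsb
  rw [map_sub] at h3 h4
  have hcs : starRingEnd ℂ s ≠ 0 := by simpa using hs
  have hprod : starRingEnd ℂ s * (a * (s - a)) = starRingEnd ℂ s * (b * (s - b)) := by
    linear_combination a * h3 + (s - a) * h1 - b * h4 - (s - b) * h2
  have := mul_left_cancel₀ hcs hprod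
  have h0 : (a - b) * (s - (a + b)) = 0 := by linear_combination this
  rcases mul_eq_zero.1 h0 with h | h
  · exact absurd (sub_eq_zero.1 h) hab
  · exact sub_eq_zero.1 h

lemma eq_sextant_one_of_im_nonneg {z : ℂ} (h : ‖z‖ = 1) (h' : ‖z - 1‖ = 1) (hi : 0 ≤ z.im) :
    z = sextant 1 := by
  have h1 := norm_sq_eq_re_im z
  have h2 := norm_sq_eq_re_im (z - 1)
  rw [h] at h1
  rw [h', Complex.sub_re, Complex.sub_im, Complex.one_re, Complex.one_im] at h2
  have hre : z.re = 1 / 2 := by linarith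
  apply Complex.ext
  · rw [hre, sextant_one_re]
  · rw [sextant_one_im, ← sq_eq_sq₀ hi (by positivity), div_pow, sq_sqrt (by norm_num)]
    rw [hre] at h1
    linarith

/-- A set of points with pairwise distances at least `1` containing no midpoint of
two of its points. -/
def SeparatedMidpointFree (Q : Set ℂ) : Prop :=
  (∀ p ∈ Q, ∀ q ∈ Q, p ≠ q → 1 ≤ ‖p - q‖) ∧
  (∀ p ∈ Q, ∀ q ∈ Q, ∀ m ∈ Q, p ≠ m → p + q ≠ 2 * m)


/-- The number of points of `Q` at unit distance from `A` is at least five. -/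
def HasFiveNeighbors (Q : Set ℂ) (A : ℂ) : Prop :=
  5 ≤ {q : ℂ | q ∈ Q ∧ ‖q - A‖ = 1}.ncard

namespace SeparatedMidpointFree

variable {Q : Set ℂ}

/-- Two neighbors of a point are at least `60°` apart. -/
lemma gap (hQ : SeparatedMidpointFree Q) {A : ℂ} {s t : ℝ} (hs : A + sextant s ∈ Q)
    (ht : A + sextant t ∈ Q) (h : s < t) (h' : t < s + 6) : s + 1 ≤ t ∧ t ≤ s + 5 := by
  have hne : A + sextant s ≠ A + sextant t := fun he => sextant_ne h h' (add_left_cancel he)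
  have h1 := hQ.1 _ hs _ ht hne
  rw [add_sub_add_left_eq_sub] at h1
  constructor
  · by_contra! hlt
    linarith [norm_sextant_sub_lt_one h hlt]
  · by_contra! hlt
    have := norm_sextant_sub_lt_one h' (by linarith : s + 6 < t + 1)
    rw [sextant_add_six, norm_sub_rev] at this
    linarith

lemma eq_or_gap (hQ : SeparatedMidpointFree Q) {A : ℂ} {s t : ℝ} (hs : A + sextant s ∈ Q)
    (ht : A + sextant t ∈ Q) (h : s < t + 6) (h' : t < s + 6) :
    t = s ∨ t ≤ s - 1 ∨ s + 1 ≤ t := by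
  rcases lt_trichotomy s t with hlt | heq | hlt
  · exact Or.inr (Or.inr (hQ.gap hs ht hlt h').1)
  · exact Or.inl heq.symm
  · exact Or.inr (Or.inl (by linarith [(hQ.gap ht hs hlt h).1]))

/-- A point has no two opposite neighbors. -/
lemma not_opposite (hQ : SeparatedMidpointFree Q) {A : ℂ} {s t : ℝ} (hA : A ∈ Q)
    (hs : A + sextant s ∈ Q) (ht : A + sextant t ∈ Q) : t ≠ s + 3 := by
  rintro rfl
  refine hQ.2 _ hs _ ht _ hA (fun h => ?_) ?_
  · have := norm_sextant s
    rw [add_eq_left.1 h] at this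
    simp at this
  · rw [sextant_add_three]; ring

/-- The neighbors of a point with at least five neighbors, starting from a given one. -/
lemma exists_fan (hQ : SeparatedMidpointFree Q) {A : ℂ} (hd : HasFiveNeighbors Q A) {a : ℝ}
    (ha : A + sextant a ∈ Q) :
    ∃ t₁ t₂ t₃ t₄ : ℝ, a + 1 ≤ t₁ ∧ t₁ + 1 ≤ t₂ ∧ t₂ + 1 ≤ t₃ ∧ t₃ + 1 ≤ t₄ ∧ t₄ ≤ a + 5 ∧
      A + sextant t₁ ∈ Q ∧ A + sextant t₂ ∈ Q ∧ A + sextant t₃ ∈ Q ∧ A + sextant t₄ ∈ Q := by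
  set N := {q : ℂ | q ∈ Q ∧ ‖q - A‖ = 1} with hN
  set T := {t : ℝ | (a ≤ t ∧ t < a + 6) ∧ A + sextant t ∈ Q} with hT
  have himg : (fun t => A + sextant t) '' T = N := by
    ext q
    constructor
    · rintro ⟨t, ht, rfl⟩
      exact ⟨ht.2, by simp [norm_sextant]⟩
    · rintro ⟨hq, hn⟩
      obtain ⟨t, h1, h2, h3⟩ := exists_sextant hn a
      have h4 : A + sextant t = q := by rw [h3]; ring
      exact ⟨t, ⟨⟨h1, h2⟩, h4 ▸ hq⟩, h4⟩
  have hinj : Set.InjOn (fun t => A + sextant t) T := by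
    intro s hs t ht he
    have he' := add_left_cancel he
    rcases lt_trichotomy s t with h | h | h
    · exact absurd he' (sextant_ne h (by linarith [ht.1.2, hs.1.1]))
    · exact h
    · exact absurd he'.symm (sextant_ne h (by linarith [hs.1.2, ht.1.1]))
  have hcard : 5 ≤ T.ncard := by
    rw [← hinj.ncard_image, himg]
    exact hd
  have hfin : T.Finite := Set.finite_of_ncard_pos (by omega)
  have h4 : 4 ≤ (hfin.toFinset.erase a).card := by
    have := Finset.pred_card_le_card_erase (s := hfin.toFinset) (a := a)
    rw [Set.ncard_eq_toFinset_card T hfin] at hcard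
    omega
  obtain ⟨F, hF, hF4⟩ := Finset.exists_subset_card_eq h4
  have hmem : ∀ i, a < F.orderEmbOfFin hF4 i ∧ F.orderEmbOfFin hF4 i < a + 6 ∧
      A + sextant (F.orderEmbOfFin hF4 i) ∈ Q := by
    intro i
    have h := Finset.mem_erase.1 (hF (F.orderEmbOfFin_mem hF4 i))
    have h' := hfin.mem_toFinset.1 h.2
    exact ⟨lt_of_le_of_ne h'.1.1 h.1.symm, h'.1.2, h'.2⟩
  have hgap : ∀ i j : Fin 4, i < j →
      F.orderEmbOfFin hF4 i + 1 ≤ F.orderEmbOfFin hF4 j := by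
    intro i j hij
    refine (hQ.gap (hmem i).2.2 (hmem j).2.2 ((F.orderEmbOfFin hF4).lt_iff_lt.2 hij) ?_).1
    linarith [(hmem j).2.1, (hmem i).1]
  exact ⟨_, _, _, _, (hQ.gap ha (hmem 0).2.2 (hmem 0).1 (hmem 0).2.1).1,
    hgap 0 1 (by decide), hgap 1 2 (by decide), hgap 2 3 (by decide),
    (hQ.gap ha (hmem 3).2.2 (hmem 3).1 (hmem 3).2.1).2,
    (hmem 0).2.2, (hmem 1).2.2, (hmem 2).2.2, (hmem 3).2.2⟩

/-- Neighbors of the two ends of a unit edge, on the same side of it, either coincide or do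
not lean towards each other. -/
lemma le_or_eq_of_edge (hQ : SeparatedMidpointFree Q) {A : ℂ} {k p q : ℝ}
    (hp : A + sextant (k + p) ∈ Q) (hq : A + sextant k + sextant (k + q) ∈ Q)
    (h0 : 0 < p) (h3 : q < 3) :
    q ≤ p ∨ A + sextant (k + p) = A + sextant k + sextant (k + q) := by
  by_contra! h
  have h1 := hQ.1 _ hp _ hq h.2
  have he : A + sextant (k + p) - (A + sextant k + sextant (k + q)) =
      sextant k * (sextant p - (1 + sextant q)) := by
    rw [sextant_add, sextant_add]; ring
  rw [he, norm_mul, norm_sextant, one_mul] at h1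
  linarith [norm_quadrilateral_lt_one h0 h.1 h3]

lemma le_of_edge (hQ : SeparatedMidpointFree Q) {A : ℂ} {k p q : ℝ}
    (hp : A + sextant (k + p) ∈ Q) (hq : A + sextant k + sextant (k + q) ∈ Q)
    (h0 : 0 < p) (h3 : q < 3) (h12 : 1 < p ∨ q < 2) : q ≤ p := by
  by_contra! h
  rcases hQ.le_or_eq_of_edge hp hq h0 h3 with h' | h'
  · linarith
  · have h1 : sextant k * (sextant p - 1) = sextant k * sextant q := by
      rw [sextant_add, sextant_add] at h'
      linear_combination h'
    have h2 := mul_left_cancel₀ (norm_ne_zero_iff.1 (by rw [norm_sextant]; norm_num)) h1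
    obtain rfl := eq_one_of_norm_sextant_sub_one h0 (by linarith)
      (by rw [h2, norm_sextant] : ‖sextant p - 1‖ = 1)
    rw [← sextant_two] at h2
    exact sextant_ne (h12.resolve_left (lt_irrefl 1)) (by linarith) h2.symm

/-- The configuration around a kernel `0, sextant 1, 1, sextant 5`. -/
structure KernelAtOrigin (Q : Set ℂ) (θ : ℝ) : Prop where
  zero_mem : (0 : ℂ) ∈ Q
  one_mem : (1 : ℂ) ∈ Q
  top_mem : sextant 1 ∈ Q
  bot_mem : sextant 5 ∈ Q
  five_zero : HasFiveNeighbors Q 0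
  five_one : HasFiveNeighbors Q 1
  five_top : HasFiveNeighbors Q (sextant 1)
  five_bot : HasFiveNeighbors Q (sextant 5)
  left_mem : sextant θ ∈ Q
  up_mem : sextant 1 + sextant θ ∈ Q
  lt : 2 < θ ∧ θ < 3

/-- The angle of a rhombus with side `0, sextant 1` outside the kernel. -/
lemma rhombus_angle (hQ : SeparatedMidpointFree Q) (h0 : (0 : ℂ) ∈ Q) (h1 : (1 : ℂ) ∈ Q)
    (hu : sextant 1 ∈ Q) (hd : sextant 5 ∈ Q) {v : ℂ} (hv : v ∈ Q) (hn : ‖v‖ = 1)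
    (hv1 : v ≠ 1) (hvu : v ≠ sextant 1) (hvd : v ≠ sextant 5) (huv : sextant 1 + v ∈ Q) :
    ∃ θ, sextant θ = v ∧ 2 < θ ∧ θ < 3 := by
  obtain ⟨θ, hθ0, hθ6, rfl⟩ := exists_sextant hn 0
  have m0 : (0 : ℂ) + sextant 0 ∈ Q := by simpa [sextant_zero] using h1
  have m1 : (0 : ℂ) + sextant 1 ∈ Q := by simpa using hu
  have m5 : (0 : ℂ) + sextant 5 ∈ Q := by simpa using hd
  have mθ : (0 : ℂ) + sextant θ ∈ Q := by simpa using hv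
  have u4 : sextant 1 + sextant 4 ∈ Q := by simpa [sextant_four] using h0
  have n0 : θ ≠ 0 := fun h => hv1 (h ▸ sextant_zero)
  have n1 : θ ≠ 1 := fun h => hvu (h ▸ rfl)
  have n5 : θ ≠ 5 := fun h => hvd (h ▸ rfl)
  have o3 := hQ.not_opposite h0 m0 mθ
  have o4 := hQ.not_opposite h0 m1 mθ
  have o2 := hQ.not_opposite h0 mθ m5
  have g0 := hQ.eq_or_gap m0 mθ (by linarith) (by linarith)
  have g1 := hQ.eq_or_gap m1 mθ (by linarith) (by linarith)
  have g5 := hQ.eq_or_gap m5 mθ (by linarith) (by linarith)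
  have g4 := hQ.eq_or_gap u4 huv (by linarith) (by linarith)
  refine ⟨θ, rfl, ?_⟩
  have a1 : 2 ≤ θ := by grind
  have a2 : θ ≤ 3 := by grind
  exact ⟨lt_of_le_of_ne a1 (by grind), lt_of_le_of_ne a2 (by grind)⟩

/-- The angle inequalities around the kernel force the last neighbor of its bottom point to
be opposite to the direction of the rhombus. -/
lemma KernelAtOrigin.sub_mem (hQ : SeparatedMidpointFree Q) {θ : ℝ}
    (h : KernelAtOrigin Q θ) : sextant 5 - sextant θ ∈ Q := by
  obtain ⟨hθ2, hθ3⟩ := h.lt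
  have l0 : (0 : ℂ) + sextant 0 ∈ Q := by simpa [sextant_zero] using h.one_mem
  have l1 : (0 : ℂ) + sextant 1 ∈ Q := by simpa using h.top_mem
  have l5 : (0 : ℂ) + sextant (-1) ∈ Q := by
    rw [← sextant_add_six]; norm_num; exact h.bot_mem
  have lθ : (0 : ℂ) + sextant θ ∈ Q := by simpa using h.left_mem
  have u4 : sextant 1 + sextant 4 ∈ Q := by simpa [sextant_four] using h.zero_mem
  have u5 : sextant 1 + sextant (-1) ∈ Q := by
    rw [← sextant_add_six (-1)]; norm_num; simpa [sextant_five] using h.one_mem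
  have r2 : 1 + sextant 2 ∈ Q := by simpa [sextant_two] using h.top_mem
  have r3 : 1 + sextant 3 ∈ Q := by simpa [sextant_three] using h.zero_mem
  have r4 : 1 + sextant (-2) ∈ Q := by
    rw [← sextant_add_six]; norm_num
    simpa [sextant_four, sextant_five, sub_eq_add_neg] using h.bot_mem
  have d1 : sextant 5 + sextant 7 ∈ Q := by
    rw [← sextant_sub_six 7]; norm_num; simpa [sextant_five] using h.one_mem
  have d2 : sextant 5 + sextant 2 ∈ Q := by
    simpa [sextant_five, sextant_two] using h.zero_mem
  -- neighbors of the left point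
  obtain ⟨φ, hφ, hφθ, hφ4⟩ : ∃ φ, (0 : ℂ) + sextant φ ∈ Q ∧ θ + 1 ≤ φ ∧ φ < 4 := by
    obtain ⟨t₁, t₂, t₃, t₄, g1, g2, g3, g4, g5, m1, m2, m3, m4⟩ := hQ.exists_fan h.five_zero l5
    have o4 := hQ.not_opposite h.zero_mem l1 m4
    have c1 := hQ.eq_or_gap l0 m1 (by linarith) (by linarith)
    have c2 := hQ.eq_or_gap l1 m2 (by linarith) (by linarith)
    have c3 := hQ.eq_or_gap lθ m3 (by linarith) (by linarith)
    have hlt : t₄ < 4 := lt_of_le_of_ne (by linarith) (by grind)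
    refine ⟨t₄, m4, ?_, hlt⟩
    rcases c3 with c | c | c <;> linarith
  -- neighbors of the top point
  obtain ⟨α, hα, hα0, hαθ⟩ :
      ∃ α, sextant 1 + sextant α ∈ Q ∧ 0 < α ∧ α ≤ θ - 2 := by
    obtain ⟨t₁, t₂, t₃, t₄, g1, g2, g3, g4, g5, m1, m2, m3, m4⟩ := hQ.exists_fan h.five_top u5
    have o2 := hQ.not_opposite h.top_mem m2 u4
    have c4 := hQ.eq_or_gap u4 m4 (by linarith) (by linarith)
    have c3 := hQ.eq_or_gap h.up_mem m3 (by linarith) (by linarith)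
    have h43 : t₃ ≤ 3 := by linarith
    have h3 : t₃ = θ := by grind
    have h1 : t₁ ≠ 0 := by
      rintro rfl
      refine hQ.not_opposite h.one_mem (s := 1) (t := 4) ?_ ?_ (by norm_num)
      · simpa [sextant_zero, add_comm] using m1
      · rw [← sextant_sub_six]; norm_num; exact r4
    exact ⟨t₁, m1, lt_of_le_of_ne (by linarith) h1.symm, by linarith⟩
  -- neighbors of the right point
  obtain ⟨ρ₁, ρ₂, hρ₁, hρ₂, hρ, hρ1, hρ2⟩ : ∃ ρ₁ ρ₂, 1 + sextant ρ₁ ∈ Q ∧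
      1 + sextant ρ₂ ∈ Q ∧ ρ₁ + 1 ≤ ρ₂ ∧ -1 < ρ₁ ∧ ρ₂ ≤ 1 := by
    obtain ⟨t₁, t₂, t₃, t₄, g1, g2, g3, g4, g5, m1, m2, m3, m4⟩ := hQ.exists_fan h.five_one r4
    have o1 := hQ.not_opposite h.one_mem m1 r2
    have c4 := hQ.eq_or_gap r3 m4 (by linarith) (by linarith)
    have c3 := hQ.eq_or_gap r2 m3 (by linarith) (by linarith)
    have h1 : -1 < t₁ := lt_of_le_of_ne (by linarith) (by grind)
    exact ⟨t₁, t₂, m1, m2, g2, h1, by grind⟩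
  -- neighbors of the bottom point
  obtain ⟨a, c, ha, hc, hac, ha3, hc6⟩ : ∃ a c, sextant 5 + sextant a ∈ Q ∧
      sextant 5 + sextant c ∈ Q ∧ a + 2 ≤ c ∧ 3 ≤ a ∧ c ≤ 6 := by
    obtain ⟨t₁, t₂, t₃, t₄, g1, g2, g3, g4, g5, m1, m2, m3, m4⟩ := hQ.exists_fan h.five_bot d2
    have o := hQ.not_opposite h.bot_mem d2 m3
    have c4 := hQ.eq_or_gap d1 m4 (by linarith) (by linarith)
    exact ⟨t₁, t₃, m1, m3, by linarith, by linarith, by grind⟩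
  have e1 : ρ₂ + 1 ≤ α + 1 := by
    refine hQ.le_of_edge (A := sextant 1) (k := -1) ?_ ?_ (by linarith) (by linarith)
      (Or.inl (by linarith))
    · convert hα using 3; ring
    · convert hρ₂ using 2
      · rw [← sextant_add_six (-1)]; norm_num; simp [sextant_five]
      · congr 1; ring
  have e2 : φ - 2 ≤ a - 2 := by
    refine hQ.le_of_edge (A := sextant 5) (k := 2) ?_ ?_ (by linarith) (by linarith)
      (Or.inr (by linarith))
    · convert ha using 3; ring
    · convert hφ using 2
      · simp [sextant_five, sextant_two]
      · congr 1; ring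
  have e3 : c - 4 ≤ ρ₁ + 2 := by
    refine hQ.le_of_edge (A := 1) (k := 4) ?_ ?_ (by linarith) (by linarith)
      (Or.inl (by linarith))
    · convert hρ₁ using 2
      rw [← sextant_sub_six]; congr 1; ring
    · convert hc using 2
      · simp [sextant_five, sextant_four, sub_eq_add_neg]
      · congr 1; ring
  have hcθ : c = θ + 3 := by linarith
  rw [hcθ, sextant_add_three, ← sub_eq_add_neg] at hc
  exact hc

/-- The two points of the rhombus outside the kernel have no common neighbor. -/
lemma KernelAtOrigin.not_common_neighbor (hQ : SeparatedMidpointFree Q) {θ : ℝ}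
    (h : KernelAtOrigin Q θ) {w : ℂ} (hw : w ∈ Q) (hl : ‖w - sextant θ‖ = 1)
    (hu : ‖w - (sextant 1 + sextant θ)‖ = 1) : False := by
  obtain ⟨hθ2, hθ3⟩ := h.lt
  have h1 : w - sextant θ ≠ 1 := by
    intro hw1
    have hr : 1 + sextant θ ∈ Q := by rwa [← hw1, sub_add_cancel]
    have r2 : 1 + sextant 2 ∈ Q := by simpa [sextant_two] using h.top_mem
    linarith [(hQ.gap r2 hr hθ2 (by linarith)).1]
  have hs := eq_add_of_norm_eq_one hl norm_one h1
    (norm_ne_zero_iff.1 (by rw [norm_sextant]; norm_num : ‖sextant 1‖ ≠ 0))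
    (by rw [norm_sub_rev, sub_sub, add_comm, hu])
    (by rw [← sextant_two, norm_sextant])
  refine hQ.2 w hw _ (h.sub_mem hQ) 0 h.zero_mem ?_ ?_
  · intro h0
    have h4 : sextant θ = sextant 5 := by
      rw [sextant_five]; linear_combination hs + h0
    exact sextant_ne (by linarith) (by linarith) h4
  · rw [sextant_five]; linear_combination -hs

lemma KernelAtOrigin.not_five (hQ : SeparatedMidpointFree Q) {θ : ℝ}
    (h : KernelAtOrigin Q θ) (hl : HasFiveNeighbors Q (sextant θ))
    (hu : HasFiveNeighbors Q (sextant 1 + sextant θ)) : False := by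
  obtain ⟨hθ2, hθ3⟩ := h.lt
  have l1 : sextant θ + sextant 1 ∈ Q := by rw [add_comm]; exact h.up_mem
  have l0 : sextant θ + sextant (θ + 3) ∈ Q := by
    rw [sextant_add_three, add_neg_cancel]; exact h.zero_mem
  have u4 : sextant 1 + sextant θ + sextant (-2) ∈ Q := by
    rw [← sextant_add_six (-2)]; norm_num
    rw [sextant_four, add_neg_cancel_comm]; exact h.left_mem
  have u0 : sextant 1 + sextant θ + sextant (θ - 3) ∈ Q := by
    rw [← sextant_add_six (θ - 3), show θ - 3 + 6 = θ + 3 by ring, sextant_add_three,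
      add_neg_cancel_right]
    exact h.top_mem
  obtain ⟨x, hx, hx2, hxθ⟩ : ∃ x, sextant θ + sextant x ∈ Q ∧ 2 ≤ x ∧ x ≤ θ := by
    obtain ⟨t₁, t₂, t₃, t₄, g1, g2, g3, g4, g5, m1, m2, m3, m4⟩ := hQ.exists_fan hl l1
    have c := hQ.eq_or_gap l0 m4 (by linarith) (by linarith)
    exact ⟨t₁, m1, by linarith, by grind⟩
  obtain ⟨y, hy, hyθ, hy3⟩ :
      ∃ y, sextant 1 + sextant θ + sextant y ∈ Q ∧ θ ≤ y ∧ y ≤ 3 := by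
    obtain ⟨t₁, t₂, t₃, t₄, g1, g2, g3, g4, g5, m1, m2, m3, m4⟩ := hQ.exists_fan hu u4
    have c := hQ.eq_or_gap u0 m1 (by linarith) (by linarith)
    exact ⟨t₄, m4, by grind, by linarith⟩
  rcases hQ.le_or_eq_of_edge (A := sextant θ) (k := 1) (p := x - 1) (q := y - 1)
      (by convert hx using 3; ring)
      (by convert hy using 2
          · ring
          · congr 1; ring) (by linarith) (by linarith) with h' | h'
  · obtain rfl : x = θ := by linarith
    exact hQ.not_opposite h.left_mem hx l0 rfl
  · refine h.not_common_neighbor hQ hx (by simp [norm_sextant]) ?_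
    rw [add_sub_cancel] at h'
    rw [h', add_comm (sextant θ), add_sub_cancel_left, norm_sextant]

end SeparatedMidpointFree

/-- An isometry of the plane onto `ℂ` sending a unit equilateral triangle to
`0, 1, sextant 1`. -/
lemma exists_isometry_triangle {L U R : Pt} (hLU : dist L U = 1) (hUR : dist U R = 1)
    (hLR : dist L R = 1) :
    ∃ f : Pt ≃ᵃⁱ[ℝ] ℂ, f L = 0 ∧ f R = 1 ∧ f U = sextant 1 := by
  obtain ⟨g, hgL, hgR⟩ : ∃ g : Pt ≃ᵃⁱ[ℝ] ℂ, g L = 0 ∧ g R = 1 := by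
    let e := Complex.orthonormalBasisOneI.repr.symm
    have hn : ‖e (R - L)‖ = 1 := by
      rw [e.norm_map, ← dist_eq_norm, dist_comm, hLR]
    let c : Circle := ⟨e (R - L), mem_sphere_zero_iff_norm.2 hn⟩
    refine ⟨(AffineIsometryEquiv.vaddConst ℝ L).symm.trans
      (e.trans (rotation c).symm).toAffineIsometryEquiv, by simp, ?_⟩
    have hc : (c : ℂ) = e (R - L) := rfl
    change (rotation c).symm (e (R - L)) = 1
    rw [LinearIsometryEquiv.symm_apply_eq, rotation_apply, hc, mul_one]
  have hn : ‖g U‖ = 1 := by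
    rw [← sub_zero (g U), ← hgL, ← dist_eq_norm, g.dist_map, dist_comm, hLU]
  have hn1 : ‖g U - 1‖ = 1 := by
    rw [← hgR, ← dist_eq_norm, g.dist_map, hUR]
  rcases le_total 0 (g U).im with hi | hi
  · exact ⟨g, hgL, hgR, eq_sextant_one_of_im_nonneg hn hn1 hi⟩
  · refine ⟨g.trans Complex.conjLIE.toAffineIsometryEquiv, by simp [hgL], by simp [hgR], ?_⟩
    refine eq_sextant_one_of_im_nonneg ?_ ?_ ?_
    · simpa using hn
    · rw [← hn1, ← Complex.norm_conj (g U - 1)]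
      simp
    · simpa using hi

lemma PennyGP.separatedMidpointFree {P : Finset Pt} (hP : PennyGP P) (f : Pt ≃ᵃⁱ[ℝ] ℂ) :
    SeparatedMidpointFree (f '' P) := by
  constructor
  · rintro _ ⟨p, hp, rfl⟩ _ ⟨q, hq, rfl⟩ hpq
    rw [← dist_eq_norm, f.dist_map]
    exact hP.1 p hp q hq fun h => hpq (h ▸ rfl)
  · rintro _ ⟨p, hp, rfl⟩ _ ⟨q, hq, rfl⟩ _ ⟨m, hm, rfl⟩ hpm h
    have hmid : m = midpoint ℝ p q := by
      apply f.injective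
      rw [← f.coe_toAffineEquiv, AffineEquiv.map_midpoint, f.coe_toAffineEquiv,
        midpoint_eq_smul_add, h]
      simp
    have hpm' : p ≠ m := fun h => hpm (h ▸ rfl)
    have hpq : p ≠ q := by
      rintro rfl
      exact hpm' (by rw [hmid, midpoint_self])
    have hmq : m ≠ q := by
      rw [hmid]
      exact fun h => hpq ((midpoint_eq_right_iff ℝ).1 h)
    refine hP.2 p hp m hm q hq hpm' hpq hmq ?_
    rw [hmid]
    exact (wbtw_midpoint ℝ p q).collinear

lemma hasFiveNeighbors_image {P : Finset Pt} {A : Pt} (f : Pt ≃ᵃⁱ[ℝ] ℂ) (h : 5 ≤ deg P A) :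
    HasFiveNeighbors (f '' P) (f A) := by
  rw [HasFiveNeighbors]
  convert h using 1
  rw [deg, ← Set.ncard_image_of_injective _ f.injective]
  congr 1
  ext z
  constructor
  · rintro ⟨⟨p, hp, rfl⟩, hz⟩
    exact ⟨p, ⟨hp, by rw [dist_comm, ← f.dist_map, dist_eq_norm, hz]⟩, rfl⟩
  · rintro ⟨p, ⟨hp, hd⟩, rfl⟩
    exact ⟨⟨p, hp, rfl⟩, by rw [← dist_eq_norm, f.dist_map, dist_comm, hd]⟩

/-- Let `L U R D` be a kernel and let `L₂, U₁ ∈ P` be points outside the kernel with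
`dist L L₂ = 1`, `dist U U₁ = 1` and `dist L₂ U₁ = 1`. Then no point of `P` is at unit
distance from both `L₂` and `U₁`; in particular, one of them has degree at most 4. -/
theorem no_common_neighbor_over_apricot (P : Finset Pt) (hP : PennyGP P)
    (L U R D L₂ U₁ : Pt) (hk : IsKernel P L U R D)
    (hL₂ : L₂ ∈ P) (hU₁ : U₁ ∈ P)
    (hL₂n : L₂ ∉ ({L, U, R, D} : Set Pt)) (hU₁n : U₁ ∉ ({L, U, R, D} : Set Pt))
    (hLL₂ : dist L L₂ = 1) (hUU₁ : dist U U₁ = 1) (hL₂U₁ : dist L₂ U₁ = 1) :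
    (∀ W ∈ P, ¬ (dist W L₂ = 1 ∧ dist W U₁ = 1)) ∧
    (deg P L₂ ≤ 4 ∨ deg P U₁ ≤ 4) := by
  obtain ⟨mL, mU, mR, mD, hne, dL, dU, dR, dD, hLU, hUR, hRD, hDL, hLR⟩ := hk
  simp only [Set.mem_insert_iff, Set.mem_singleton_iff, not_or] at hL₂n hU₁n
  obtain ⟨f, fL, fR, fU⟩ := exists_isometry_triangle hLU hUR hLR
  have hQ := hP.separatedMidpointFree f
  have mem : ∀ {p}, p ∈ P → f p ∈ f '' (P : Set Pt) := fun hp => ⟨_, hp, rfl⟩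
  have norm_sub : ∀ p q, ‖f p - f q‖ = dist p q := fun p q => by
    rw [← dist_eq_norm, f.dist_map]
  have norm_L : ∀ p, ‖f p‖ = dist p L := fun p => by rw [← norm_sub, fL, sub_zero]
  have fD : f D = sextant 5 := by
    have hUD : U ≠ D := by simp at hne; tauto
    have := eq_add_of_norm_eq_one (a := f U) (b := f D) (s := f R)
      (by rw [norm_L, dist_comm, hLU]) (by rw [norm_L, hDL]) (fun h => hUD (f.injective h))
      (by rw [fR]; exact one_ne_zero) (by rw [norm_sub, dist_comm, hUR]) (by rw [norm_sub, hRD])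
    rw [sextant_five, ← fU, ← fR, this]
    ring
  have fU₁ : f U₁ = sextant 1 + f L₂ := by
    rw [← fU]
    exact eq_add_of_norm_eq_one (by rw [norm_L, dist_comm, hLU])
      (by rw [norm_L, dist_comm, hLL₂]) (fun h => hL₂n.2.1 (f.injective h).symm)
      (fun h => hU₁n.1 (f.injective (h.trans fL.symm))) (by rw [norm_sub, dist_comm, hUU₁])
      (by rw [norm_sub, dist_comm, hL₂U₁])
  have z0 := fL ▸ mem mL
  have z1 := fR ▸ mem mR
  have zU := fU ▸ mem mU
  have zD := fD ▸ mem mD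
  have zU₁ := fU₁ ▸ mem hU₁
  obtain ⟨θ, hθ, hlt⟩ := hQ.rhombus_angle z0 z1 zU zD (mem hL₂)
    (by rw [norm_L, dist_comm, hLL₂])
    (fun h => hL₂n.2.2.1 (f.injective (h.trans fR.symm)))
    (fun h => hL₂n.2.1 (f.injective (h.trans fU.symm)))
    (fun h => hL₂n.2.2.2 (f.injective (h.trans fD.symm))) zU₁
  have hK : SeparatedMidpointFree.KernelAtOrigin (f '' P) θ :=
    { zero_mem := z0
      one_mem := z1
      top_mem := zU
      bot_mem := zD
      five_zero := fL ▸ hasFiveNeighbors_image f dL.ge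
      five_one := fR ▸ hasFiveNeighbors_image f dR.ge
      five_top := fU ▸ hasFiveNeighbors_image f dU.ge
      five_bot := fD ▸ hasFiveNeighbors_image f dD.ge
      left_mem := hθ ▸ mem hL₂
      up_mem := hθ ▸ zU₁
      lt := hlt }
  constructor
  · rintro W hW ⟨h1, h2⟩
    refine hK.not_common_neighbor hQ (mem hW) ?_ ?_
    · rw [hθ, norm_sub, h1]
    · rw [hθ, ← fU₁, norm_sub, h2]
  · by_contra! h
    refine hK.not_five hQ ?_ ?_
    · rw [hθ]
      exact hasFiveNeighbors_image f h.1
    · rw [hθ, ← fU₁]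
      exact hasFiveNeighbors_image f h.2
end
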